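/- (Main Theorem: distribution of periodic Lyapunov exponents.) Suppose f is not smoothly conjugate to the linear map m_K(x) = Kx, and let χ̄ = ∫ h dμ be the Lyapunov exponent of f with respect to the measure of maximal entropy. Then there exist constants σ > 0 and C > 0 such that for every integer n ≥ 1 and all a, b ∈ ℝ ∪ {+∞} with a < b, | ℙ( √n·(χ_n − χ̄)/σ ∈ [a, b] ) − (1/√(2π))·∫_a^b exp(−x²/2) dx | ≤ C·n^{−1/4}. -/

import Mathlib

open MeasureTheory Filter
noncomputable section

/-- The set of periodic points of period `n` (not necessarily least period). -/
def FixPts (f : AddCircle (1:ℝ) → AddCircle (1:ℝ)) (n : ℕ) : Set (AddCircle (1:ℝ)) :=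
  {p | f^[n] p = p}

/-- The transfer operator `ℒφ(x) = ∑_{f y = x} φ y`. -/
def transfer (f : AddCircle (1:ℝ) → AddCircle (1:ℝ)) (φ : AddCircle (1:ℝ) → ℝ) : AddCircle (1:ℝ) → ℝ :=
  fun x => ∑ᶠ y ∈ f ⁻¹' {x}, φ y

/-- The periodic Lyapunov exponent `χ_n(p) = (1/n) ∑_{k<n} log f'(fᵏ p)`. -/
def chi (f : AddCircle (1:ℝ) → AddCircle (1:ℝ)) (f' : AddCircle (1:ℝ) → ℝ) (n : ℕ) (p : AddCircle (1:ℝ)) : ℝ :=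
  (n : ℝ)⁻¹ * ∑ k ∈ Finset.range n, Real.log (f' (f^[k] p))

/-- `f` is smoothly conjugate to the linear map `m_K(x) = Kx`: there is a C¹
diffeomorphism `u` of the circle (given by a C¹ lift `U` with nonvanishing
derivative) with `u ∘ f = m_K ∘ u`. -/
def SmoothConj (K : ℕ) (f : AddCircle (1:ℝ) → AddCircle (1:ℝ)) : Prop :=
  ∃ (u : AddCircle (1:ℝ) → AddCircle (1:ℝ)) (U : ℝ → ℝ), Function.Bijective u ∧ ContDiff ℝ 1 U ∧
    (∀ x : ℝ, deriv U x ≠ 0) ∧ (∀ x : ℝ, u (x : AddCircle (1:ℝ)) = ((U x : ℝ) : AddCircle (1:ℝ))) ∧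
    (∀ p : AddCircle (1:ℝ), u (f p) = K • u p)



/-! ### Gaussian part -/

def gd (x : ℝ) : ℝ := (Real.sqrt (2 * Real.pi))⁻¹ * Real.exp (-x ^ 2 / 2)

def Phi (x : ℝ) : ℝ := (Real.sqrt (2 * Real.pi))⁻¹ * ∫ t in Set.Iic x, Real.exp (-t ^ 2 / 2)

lemma gauss_integrable : Integrable (fun t : ℝ => Real.exp (-t ^ 2 / 2)) := by
  have := integrable_exp_neg_mul_sq (b := 1/2) (by norm_num)
  refine this.congr (Eventually.of_forall fun t => ?_)
  simp only; congr 1; ring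

lemma gauss_total : ∫ t : ℝ, Real.exp (-t ^ 2 / 2) = Real.sqrt (2 * Real.pi) := by
  have := integral_gaussian (1/2)
  rw [show Real.pi / (1/2) = 2 * Real.pi by ring] at this
  rw [← this]; congr 1; ext t; congr 1; ring

lemma sqrt2pi_pos : 0 < Real.sqrt (2 * Real.pi) := Real.sqrt_pos.2 (by positivity)

lemma sqrt2pi_ge : 2 ≤ Real.sqrt (2 * Real.pi) := by
  apply Real.le_sqrt_of_sq_le; nlinarith [Real.pi_gt_three]

lemma sqrt2pi_inv_le : (Real.sqrt (2 * Real.pi))⁻¹ ≤ 1 / 2 := by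
  rw [inv_le_comm₀ sqrt2pi_pos (by norm_num)]; simpa using sqrt2pi_ge

lemma Phi_sub (x y : ℝ) :
    Phi y - Phi x = (Real.sqrt (2 * Real.pi))⁻¹ * ∫ t in x..y, Real.exp (-t ^ 2 / 2) := by
  unfold Phi
  rw [← mul_sub, intervalIntegral.integral_Iic_sub_Iic gauss_integrable.integrableOn
    gauss_integrable.integrableOn]

lemma Phi_hasDeriv (x : ℝ) : HasDerivAt Phi (gd x) x := by
  have hc : Continuous (fun t : ℝ => Real.exp (-t ^ 2 / 2)) := by fun_prop
  have h := intervalIntegral.integral_hasDerivAt_right (f := fun t : ℝ => Real.exp (-t ^ 2 / 2))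
    (a := 0) (b := x) (hc.intervalIntegrable _ _)
    hc.stronglyMeasurable.stronglyMeasurableAtFilter hc.continuousAt
  have h2 := (h.const_mul (Real.sqrt (2 * Real.pi))⁻¹).const_add (Phi 0)
  refine h2.congr_of_eventuallyEq (Eventually.of_forall fun y => ?_)
  have := Phi_sub 0 y
  simp only; linarith

lemma gd_nonneg (x : ℝ) : 0 ≤ gd x := by unfold gd; positivity

lemma Phi_mono : Monotone Phi :=
  monotone_of_hasDerivAt_nonneg Phi_hasDeriv gd_nonneg

lemma Phi_nonneg (x : ℝ) : 0 ≤ Phi x := by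
  unfold Phi
  have : 0 ≤ ∫ t in Set.Iic x, Real.exp (-t ^ 2 / 2) := integral_nonneg fun t => by positivity
  positivity

lemma one_sub_Phi (x : ℝ) :
    1 - Phi x = (Real.sqrt (2 * Real.pi))⁻¹ * ∫ t in Set.Ioi x, Real.exp (-t ^ 2 / 2) := by
  have h := intervalIntegral.integral_Iic_add_Ioi (b := x) gauss_integrable.integrableOn
    gauss_integrable.integrableOn
  rw [gauss_total] at h
  have h2 : (Real.sqrt (2 * Real.pi))⁻¹ * Real.sqrt (2 * Real.pi) = 1 :=
    inv_mul_cancel₀ sqrt2pi_pos.ne'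
  unfold Phi
  rw [← h2, ← h]; ring

lemma Phi_le_one (x : ℝ) : Phi x ≤ 1 := by
  have := one_sub_Phi x
  have h : 0 ≤ ∫ t in Set.Ioi x, Real.exp (-t ^ 2 / 2) := integral_nonneg fun t => by positivity
  have : 0 ≤ 1 - Phi x := by rw [this]; positivity
  linarith

lemma exp_half_le : Real.exp (1 / 2) ≤ 2 := by
  have h1 := Real.exp_one_lt_d9
  have : Real.exp (1/2) * Real.exp (1/2) = Real.exp 1 := by rw [← Real.exp_add]; norm_num
  nlinarith [Real.exp_pos (1/2)]

lemma gauss_le_exp (t : ℝ) : Real.exp (-t ^ 2 / 2) ≤ 2 * Real.exp (-t) := by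
  calc Real.exp (-t ^ 2 / 2) ≤ Real.exp (1/2 + -t) := by
        apply Real.exp_le_exp.2; nlinarith [sq_nonneg (t - 1)]
    _ = Real.exp (1/2) * Real.exp (-t) := Real.exp_add _ _
    _ ≤ _ := by gcongr; exact exp_half_le

lemma one_sub_Phi_le (x : ℝ) : 1 - Phi x ≤ Real.exp (-x) := by
  rw [one_sub_Phi]
  have h : ∫ t in Set.Ioi x, Real.exp (-t ^ 2 / 2) ≤ ∫ t in Set.Ioi x, 2 * Real.exp (-t) := by
    apply setIntegral_mono gauss_integrable.integrableOn
    · exact (integrableOn_exp_neg_Ioi x).const_mul 2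
    · exact gauss_le_exp
  rw [integral_const_mul, integral_exp_neg_Ioi] at h
  calc _ ≤ 1/2 * (2 * Real.exp (-x)) := by
        gcongr
        exact sqrt2pi_inv_le
    _ = _ := by ring

lemma Phi_le (x : ℝ) : Phi x ≤ Real.exp x := by
  unfold Phi
  have h : ∫ t in Set.Iic x, Real.exp (-t ^ 2 / 2) ≤ ∫ t in Set.Iic x, 2 * Real.exp t := by
    apply setIntegral_mono gauss_integrable.integrableOn
    · exact (integrableOn_exp_Iic x).const_mul 2
    · intro t; simpa using gauss_le_exp (-t)
  rw [integral_const_mul, integral_exp_Iic] at h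
  calc _ ≤ 1/2 * (2 * Real.exp x) := by
        gcongr
        exact sqrt2pi_inv_le
    _ = _ := by ring

lemma gd_bound (x : ℝ) : gd x * (1 + x ^ 2 / 2 + x ^ 4 / 8) ≤ 1 / 2 := by
  have h1 : 1 + x ^ 2 / 2 + x ^ 4 / 8 ≤ Real.exp (x ^ 2 / 2) := by
    have := Real.quadratic_le_exp_of_nonneg (x := x ^ 2 / 2) (by positivity)
    nlinarith
  have h2 : Real.exp (-x ^ 2 / 2) * Real.exp (x ^ 2 / 2) = 1 := by
    rw [← Real.exp_add]; ring_nf; simp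
  calc gd x * (1 + x ^ 2 / 2 + x ^ 4 / 8) ≤ gd x * Real.exp (x ^ 2 / 2) := by
        gcongr; exact gd_nonneg x
    _ = (Real.sqrt (2 * Real.pi))⁻¹ * 1 := by unfold gd; rw [mul_assoc, h2]
    _ ≤ 1 / 2 := by linarith [sqrt2pi_inv_le]

lemma gd_le_one (x : ℝ) : gd x ≤ 1 := by
  have := gd_bound x; have := gd_nonneg x
  nlinarith [mul_nonneg this (sq_nonneg x), mul_nonneg this (by positivity : 0 ≤ x ^ 4)]

lemma gd_poly1 (x : ℝ) : |x| * gd x ≤ 1 := by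
  have h := gd_bound x; have h0 := gd_nonneg x
  have : |x| ≤ 2 * (1 + x ^ 2 / 2 + x ^ 4 / 8) := by
    have := sq_abs x
    nlinarith [sq_nonneg (|x| - 1), (by positivity : 0 ≤ x ^ 4)]
  nlinarith [mul_le_mul_of_nonneg_right this h0]

lemma gd_poly2 (x : ℝ) : |x ^ 2 - 1| * gd x ≤ 1 := by
  have h := gd_bound x; have h0 := gd_nonneg x
  have : |x ^ 2 - 1| ≤ 2 * (1 + x ^ 2 / 2 + x ^ 4 / 8) := by
    rw [abs_le]; constructor <;> nlinarith [sq_nonneg x, (by positivity : 0 ≤ x ^ 4)]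
  nlinarith [mul_le_mul_of_nonneg_right this h0]

lemma gd_poly3 (x : ℝ) : |3 / 2 * x - x ^ 3 / 2| * gd x ≤ 3 := by
  have h := gd_bound x; have h0 := gd_nonneg x
  have : |3 / 2 * x - x ^ 3 / 2| ≤ 6 * (1 + x ^ 2 / 2 + x ^ 4 / 8) := by
    rw [abs_le]; constructor <;>
    nlinarith [sq_nonneg (x-1), sq_nonneg (x+1), sq_nonneg (x^2+x), sq_nonneg (x^2-x), sq_nonneg x, (by positivity : 0 ≤ x ^ 4)]
  nlinarith [mul_le_mul_of_nonneg_right this h0]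

lemma Phi_lip (x y : ℝ) : |Phi x - Phi y| ≤ |x - y| := by
  have := Convex.norm_image_sub_le_of_norm_hasDerivWithin_le (f := Phi) (f' := gd) (C := 1)
    (s := Set.univ) (x := y) (y := x)
    (fun z _ => (Phi_hasDeriv z).hasDerivWithinAt)
    (fun z _ => by rw [Real.norm_eq_abs, abs_of_nonneg (gd_nonneg z)]; exact gd_le_one z)
    convex_univ (Set.mem_univ _) (Set.mem_univ _)
  simpa using this

def NN (τ u : ℝ) : ℝ := Phi (u / Real.sqrt τ)
def NNu (τ u : ℝ) : ℝ := gd (u / Real.sqrt τ) / Real.sqrt τ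
def NNuu (τ u : ℝ) : ℝ := - (u / Real.sqrt τ) * gd (u / Real.sqrt τ) / τ

lemma gd_hasDeriv (x : ℝ) : HasDerivAt gd (-x * gd x) x := by
  unfold gd
  have h : HasDerivAt (fun x : ℝ => -x ^ 2 / 2) (-x) x := by
    have := ((hasDerivAt_pow 2 x).neg).div_const 2
    refine this.congr_deriv ?_
    push_cast; ring
  have := (h.exp).const_mul (Real.sqrt (2 * Real.pi))⁻¹
  refine this.congr_deriv ?_
  ring

lemma NN_du (τ u : ℝ) : HasDerivAt (NN τ) (NNu τ u) u := by
  have h := (Phi_hasDeriv (u / Real.sqrt τ)).comp u ((hasDerivAt_id u).div_const (Real.sqrt τ))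
  refine h.congr_deriv ?_
  unfold NNu; ring

lemma NNu_du (τ u : ℝ) (hτ : 0 < τ) : HasDerivAt (NNu τ) (NNuu τ u) u := by
  have h := ((gd_hasDeriv (u / Real.sqrt τ)).comp u
    ((hasDerivAt_id u).div_const (Real.sqrt τ))).div_const (Real.sqrt τ)
  refine h.congr_deriv ?_
  unfold NNuu
  have := Real.sqrt_pos.2 hτ
  have h2 := Real.mul_self_sqrt hτ.le
  generalize Real.sqrt τ = s at *
  subst h2
  field_simp

lemma NNuu_du (τ u : ℝ) (hτ : 0 < τ) :
    HasDerivAt (NNuu τ) (((u / Real.sqrt τ) ^ 2 - 1) * gd (u / Real.sqrt τ) / (τ * Real.sqrt τ)) u := by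
  have h1 := (hasDerivAt_id u).div_const (Real.sqrt τ)
  have h := ((h1.neg).mul ((gd_hasDeriv (u / Real.sqrt τ)).comp u h1)).div_const τ
  refine h.congr_deriv ?_
  have := Real.sqrt_pos.2 hτ
  simp only [id, Function.comp]
  simp
  field_simp
  ring

lemma NN_dt (τ u : ℝ) (hτ : 0 < τ) : HasDerivAt (fun t => NN t u) (NNuu τ u / 2) τ := by
  have hs := Real.sqrt_pos.2 hτ
  have h1 := (hasDerivAt_const τ u).div (Real.hasDerivAt_sqrt hτ.ne') hs.ne'
  have h := (Phi_hasDeriv (u / Real.sqrt τ)).comp τ h1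
  refine h.congr_deriv ?_
  unfold NNuu
  have h2 := Real.mul_self_sqrt hτ.le
  generalize Real.sqrt τ = s at *
  subst h2
  field_simp
  ring

lemma NNuu_dt (τ u : ℝ) (hτ : 0 < τ) : HasDerivAt (fun t => NNuu t u)
    ((3 / 2 * (u / Real.sqrt τ) - (u / Real.sqrt τ) ^ 3 / 2) * gd (u / Real.sqrt τ) / τ ^ 2) τ := by
  have hs := Real.sqrt_pos.2 hτ
  have h1 := (hasDerivAt_const τ u).div (Real.hasDerivAt_sqrt hτ.ne') hs.ne'
  have h := ((h1.neg).mul ((gd_hasDeriv (u / Real.sqrt τ)).comp τ h1)).div (hasDerivAt_id τ) hτ.ne'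
  refine h.congr_deriv ?_
  simp only [id, Function.comp]
  have h2 := Real.mul_self_sqrt hτ.le
  simp
  generalize Real.sqrt τ = s at *
  subst h2
  field_simp
  ring

lemma NNuu_bound (τ u : ℝ) (hτ : 0 < τ) : |NNuu τ u| ≤ 1 / τ := by
  unfold NNuu
  rw [abs_div, abs_mul, abs_neg, abs_of_pos hτ, abs_of_nonneg (gd_nonneg _)]
  gcongr
  exact gd_poly1 _

lemma NNuu_lip (τ u v : ℝ) (hτ : 0 < τ) :
    |NNuu τ u - NNuu τ v| ≤ 1 / (τ * Real.sqrt τ) * |u - v| := by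
  have hs := Real.sqrt_pos.2 hτ
  have := Convex.norm_image_sub_le_of_norm_hasDerivWithin_le (f := NNuu τ)
    (C := 1 / (τ * Real.sqrt τ)) (s := Set.univ) (x := v) (y := u)
    (fun z _ => (NNuu_du τ z hτ).hasDerivWithinAt)
    (fun z _ => by
      rw [Real.norm_eq_abs, abs_div, abs_mul, abs_of_nonneg (gd_nonneg _),
        abs_of_pos (mul_pos hτ hs)]
      gcongr
      exact gd_poly2 _)
    convex_univ (Set.mem_univ _) (Set.mem_univ _)
  simpa using this

lemma NNuu_tlip (τ v u : ℝ) (hτ : 0 < τ) (hv : 0 ≤ v) :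
    |NNuu (τ + v) u - NNuu τ u| ≤ 3 / τ ^ 2 * v := by
  have := Convex.norm_image_sub_le_of_norm_hasDerivWithin_le (f := fun t => NNuu t u)
    (C := 3 / τ ^ 2) (s := Set.Ici τ) (x := τ) (y := τ + v)
    (fun z hz => (NNuu_dt z u (lt_of_lt_of_le hτ hz)).hasDerivWithinAt)
    (fun z hz => by
      have hz' : τ ≤ z := hz
      have hz0 : 0 < z := lt_of_lt_of_le hτ hz
      rw [Real.norm_eq_abs, abs_div, abs_mul, abs_of_nonneg (gd_nonneg _),
        abs_of_pos (by positivity : 0 < z ^ 2)]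
      gcongr
      exact gd_poly3 _)
    (convex_Ici _) (by simp) (by simpa using hv)
  simpa [abs_of_nonneg hv] using this

lemma NN_tlip (τ v u : ℝ) (hτ : 0 < τ) (hv : 0 ≤ v) :
    |NN (τ + v) u - NN τ u| ≤ 1 / τ * v := by
  have := Convex.norm_image_sub_le_of_norm_hasDerivWithin_le (f := fun t => NN t u)
    (C := 1 / τ) (s := Set.Ici τ) (x := τ) (y := τ + v)
    (fun z hz => (NN_dt z u (lt_of_lt_of_le hτ hz)).hasDerivWithinAt)
    (fun z hz => by
      have hz' : τ ≤ z := hz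
      have hz0 : 0 < z := lt_of_lt_of_le hτ hz
      rw [Real.norm_eq_abs, abs_div]
      have h1 := NNuu_bound z u hz0
      have h2 : 1 / z ≤ 1 / τ := by gcongr
      have h3 := abs_nonneg (NNuu z u)
      rw [abs_two]; linarith)
    (convex_Ici _) (by simp) (by simpa using hv)
  simpa [abs_of_nonneg hv] using this

lemma NN_ttaylor (τ v u : ℝ) (hτ : 0 < τ) (hv : 0 ≤ v) :
    |NN (τ + v) u - NN τ u - v * (NNuu τ u / 2)| ≤ 3 / τ ^ 2 * v ^ 2 := by
  have := Convex.norm_image_sub_le_of_norm_hasDerivWithin_le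
    (f := fun t => NN t u - t * (NNuu τ u / 2))
    (C := 3 / τ ^ 2 * v) (s := Set.Icc τ (τ + v)) (x := τ) (y := τ + v)
    (fun z hz => ((NN_dt z u (lt_of_lt_of_le hτ hz.1)).sub
      ((hasDerivAt_id z).mul_const (NNuu τ u / 2))).hasDerivWithinAt)
    (fun z hz => by
      have h := NNuu_tlip τ (z - τ) u hτ (by linarith [hz.1])
      rw [show τ + (z - τ) = z by ring] at h
      have : 3 / τ ^ 2 * (z - τ) ≤ 3 / τ ^ 2 * v := by
        gcongr; linarith [hz.2]
      rw [Real.norm_eq_abs, show NNuu z u / 2 - 1 * (NNuu τ u / 2) = (NNuu z u - NNuu τ u) / 2 by ring,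
        abs_div, abs_two]
      have h3 := abs_nonneg (NNuu z u - NNuu τ u)
      linarith)
    (convex_Icc _ _) (by simpa using hv) (by simpa using hv)
  simp only [Real.norm_eq_abs] at this
  rw [show τ + v - τ = v by ring, abs_of_nonneg hv] at this
  calc _ = |NN (τ + v) u - (τ + v) * (NNuu τ u / 2) - (NN τ u - τ * (NNuu τ u / 2))| := by
        congr 1; ring
    _ ≤ _ := this
    _ = _ := by ring

/-- Second-order Taylor with Lipschitz second derivative. -/
lemma taylor2 (φ φ1 φ2 : ℝ → ℝ) (C : ℝ) (hC : 0 ≤ C) (h1 : ∀ x, HasDerivAt φ (φ1 x) x)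
    (h2 : ∀ x, HasDerivAt φ1 (φ2 x) x) (h3 : ∀ x y, |φ2 x - φ2 y| ≤ C * |x - y|) (x d : ℝ) :
    |φ (x + d) - φ x - d * φ1 x - d ^ 2 / 2 * φ2 x| ≤ C * |d| ^ 3 := by
  have key1 : ∀ y ∈ Metric.closedBall x |d|, |φ1 y - φ1 x - (y - x) * φ2 x| ≤ C * |d| ^ 2 := by
    intro y hy
    have := Convex.norm_image_sub_le_of_norm_hasDerivWithin_le
      (f := fun t => φ1 t - t * φ2 x)
      (C := C * |d|) (s := Metric.closedBall x |d|) (x := x) (y := y)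
      (fun z _ => ((h2 z).sub ((hasDerivAt_id z).mul_const (φ2 x))).hasDerivWithinAt)
      (fun z hz => by
        rw [one_mul]
        refine (h3 z x).trans (mul_le_mul_of_nonneg_left ?_ hC)
        simpa [Real.dist_eq] using hz)
      (convex_closedBall _ _) (by simp) hy
    simp only [Real.norm_eq_abs] at this
    have hyd : |y - x| ≤ |d| := by simpa [Real.dist_eq] using hy
    calc _ = |φ1 y - y * φ2 x - (φ1 x - x * φ2 x)| := by congr 1; ring
      _ ≤ C * |d| * |y - x| := this
      _ ≤ C * |d| * |d| := by gcongr
      _ = _ := by ring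
  have := Convex.norm_image_sub_le_of_norm_hasDerivWithin_le
      (f := fun t => φ t - t * φ1 x - (t - x) ^ 2 / 2 * φ2 x)
      (f' := fun z => φ1 z - φ1 x - (z - x) * φ2 x)
      (C := C * |d| ^ 2) (s := Metric.closedBall x |d|) (x := x) (y := x + d)
      (fun z _ => by
        have hq : HasDerivAt (fun t : ℝ => (t - x) ^ 2 / 2) (z - x) z := by
          have := (((hasDerivAt_id z).sub_const x).pow 2).div_const 2
          refine this.congr_deriv ?_
          simp
        refine ((((h1 z).sub ((hasDerivAt_id z).mul_const (φ1 x))).sub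
          (hq.mul_const (φ2 x))).congr_deriv ?_).hasDerivWithinAt
        ring)
      (fun z hz => by
        rw [Real.norm_eq_abs]
        exact key1 z hz)
      (convex_closedBall _ _) (by simp) (by simp)
  simp only [Real.norm_eq_abs] at this
  rw [show x + d - x = d by ring] at this
  calc _ = |φ (x + d) - (x + d) * φ1 x - d ^ 2 / 2 * φ2 x
      - (φ x - x * φ1 x - (x - x) ^ 2 / 2 * φ2 x)| := by congr 1; ring
    _ ≤ _ := this
    _ = _ := by ring

lemma NN_utaylor (τ u d : ℝ) (hτ : 0 < τ) :
    |NN τ (u - d) - NN τ u + d * NNu τ u - d ^ 2 / 2 * NNuu τ u| ≤ 1 / (τ * Real.sqrt τ) * |d| ^ 3 := by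
  have := taylor2 (NN τ) (NNu τ) (NNuu τ) (1 / (τ * Real.sqrt τ)) (by positivity) (NN_du τ)
    (fun x => NNu_du τ x hτ) (fun x y => NNuu_lip τ x y hτ) u (-d)
  rw [abs_neg] at this
  calc _ = |NN τ (u + -d) - NN τ u - -d * NNu τ u - (-d) ^ 2 / 2 * NNuu τ u| := by
        rw [← sub_eq_add_neg]; congr 1; ring
    _ ≤ _ := this

def HH (τ e u : ℝ) : ℝ := NN τ u + NNuu τ u / 2 * e

/-- one-step estimate -/
lemma one_step (K : ℕ) (hK : 1 ≤ K) (m e : ℕ → ℝ) (e0 v B τ u : ℝ) (hv : 0 ≤ v) (hτ : 1 ≤ τ)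
    (hm : ∀ i, |m i| ≤ B) (he : ∀ i, |e i| ≤ B) (he0 : |e0| ≤ B)
    (hm0 : ∑ i ∈ Finset.range K, m i = 0)
    (hme : (K : ℝ)⁻¹ * ∑ i ∈ Finset.range K, (m i ^ 2 + e i) = v + e0) :
    |(K : ℝ)⁻¹ * ∑ i ∈ Finset.range K, HH τ (e i) (u - m i) - HH (τ + v) e0 u| ≤
      (B ^ 3 + B ^ 2 + 3 * v ^ 2 + 3 * v * B) * (1 / (τ * Real.sqrt τ)) := by
  have hτ0 : 0 < τ := by linarith
  have hB : 0 ≤ B := (abs_nonneg _).trans he0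
  have hK0 : (0:ℝ) < K := by exact_mod_cast hK
  set Q := 1 / (τ * Real.sqrt τ) with hQ
  have hsq : Real.sqrt τ ≤ τ := by
    rw [Real.sqrt_le_left hτ0.le]; nlinarith
  have hQ2 : 1 / τ ^ 2 ≤ Q := by
    rw [hQ, sq]
    have := Real.sqrt_pos.2 hτ0
    gcongr
  have hQ0 : 0 ≤ Q := by rw [hQ]; positivity
  -- termwise
  have term : ∀ i, |HH τ (e i) (u - m i) - (NN τ u - m i * NNu τ u + NNuu τ u / 2 * (m i ^ 2 + e i))|
      ≤ (B ^ 3 + B ^ 2) * Q := by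
    intro i
    have h1 := NN_utaylor τ u (m i) hτ0
    have h2 := NNuu_lip τ (u - m i) u hτ0
    rw [← hQ] at h1 h2
    rw [show u - m i - u = - m i by ring, abs_neg] at h2
    have h1' : |NN τ (u - m i) - NN τ u + m i * NNu τ u - m i ^ 2 / 2 * NNuu τ u| ≤ Q * B ^ 3 := by
      refine h1.trans ?_
      gcongr
      exact hm i
    have h2' : |(NNuu τ (u - m i) - NNuu τ u) / 2 * e i| ≤ Q * B ^ 2 := by
      rw [abs_mul, abs_div, abs_two]
      have : |NNuu τ (u - m i) - NNuu τ u| / 2 ≤ Q * B := by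
        have : Q * |m i| ≤ Q * B := by gcongr; exact hm i
        have h3 := abs_nonneg (NNuu τ (u - m i) - NNuu τ u)
        linarith
      calc _ ≤ Q * B * B := by
            gcongr
            exact he i
        _ = _ := by ring
    calc _ = |(NN τ (u - m i) - NN τ u + m i * NNu τ u - m i ^ 2 / 2 * NNuu τ u) +
        (NNuu τ (u - m i) - NNuu τ u) / 2 * e i| := by unfold HH; congr 1; ring
      _ ≤ _ := abs_add_le _ _
      _ ≤ _ := by linarith
  have sum1 : |(K : ℝ)⁻¹ * ∑ i ∈ Finset.range K, HH τ (e i) (u - m i) -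
      (NN τ u + NNuu τ u / 2 * (v + e0))| ≤ (B ^ 3 + B ^ 2) * Q := by
    have e1 : NN τ u + NNuu τ u / 2 * (v + e0) = (K : ℝ)⁻¹ * ∑ i ∈ Finset.range K,
        (NN τ u - m i * NNu τ u + NNuu τ u / 2 * (m i ^ 2 + e i)) := by
      have e3 : ∑ i ∈ Finset.range K, (NN τ u - m i * NNu τ u + NNuu τ u / 2 * (m i ^ 2 + e i)) =
          K * NN τ u + NNuu τ u / 2 * ∑ i ∈ Finset.range K, (m i ^ 2 + e i) := by
        rw [Finset.sum_add_distrib (f := fun i => NN τ u - m i * NNu τ u), Finset.sum_sub_distrib,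
          ← Finset.sum_mul, hm0, ← Finset.mul_sum]
        simp
      rw [e3, ← hme]
      field_simp
    rw [e1, ← mul_sub, ← Finset.sum_sub_distrib, abs_mul, abs_of_pos (inv_pos.2 hK0)]
    calc _ ≤ (K : ℝ)⁻¹ * ∑ i ∈ Finset.range K, (B ^ 3 + B ^ 2) * Q := by
          gcongr
          refine (Finset.abs_sum_le_sum_abs _ _).trans ?_
          exact Finset.sum_le_sum fun i _ => term i
      _ = _ := by simp; field_simp
  have b1 := NN_ttaylor τ v u hτ0 hv
  have b2 := NNuu_tlip τ v u hτ0 hv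
  have b1' : |NN (τ + v) u - NN τ u - v * (NNuu τ u / 2)| ≤ 3 * v ^ 2 * Q := by
    refine b1.trans ?_
    calc 3 / τ ^ 2 * v ^ 2 = 3 * v ^ 2 * (1 / τ ^ 2) := by ring
      _ ≤ _ := by gcongr
  have b2' : |(NNuu (τ + v) u - NNuu τ u) / 2 * e0| ≤ 3 * v * B * Q := by
    rw [abs_mul, abs_div, abs_two]
    have : |NNuu (τ + v) u - NNuu τ u| / 2 ≤ 3 * v * Q := by
      have : 3 / τ ^ 2 * v ≤ 3 * v * Q := by
        calc 3 / τ ^ 2 * v = 3 * v * (1 / τ ^ 2) := by ring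
          _ ≤ _ := by gcongr
      have h3 := abs_nonneg (NNuu (τ + v) u - NNuu τ u)
      linarith
    calc _ ≤ 3 * v * Q * B := by gcongr
      _ = _ := by ring
  have e2 : (K : ℝ)⁻¹ * ∑ i ∈ Finset.range K, HH τ (e i) (u - m i) - HH (τ + v) e0 u =
      ((K : ℝ)⁻¹ * ∑ i ∈ Finset.range K, HH τ (e i) (u - m i) -
      (NN τ u + NNuu τ u / 2 * (v + e0))) - (NN (τ + v) u - NN τ u - v * (NNuu τ u / 2))
      - ((NNuu (τ + v) u - NNuu τ u) / 2 * e0) := by unfold HH; ring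
  rw [e2]
  refine (abs_sub _ _).trans ?_
  have := abs_sub ((K : ℝ)⁻¹ * ∑ i ∈ Finset.range K, HH τ (e i) (u - m i) -
      (NN τ u + NNuu τ u / 2 * (v + e0))) (NN (τ + v) u - NN τ u - v * (NNuu τ u / 2))
  nlinarith

/-- telescoping potential -/
lemma potential (v τ : ℝ) (hv : 0 < v) (hτ : 1 ≤ τ) :
    1 / (τ * Real.sqrt τ) ≤ (2 * (1 + v) ^ 2 / v) * (1 / Real.sqrt τ - 1 / Real.sqrt (τ + v)) := by
  have hτ0 : 0 < τ := by linarith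
  have hs := Real.sqrt_pos.2 hτ0
  have ht := Real.sqrt_pos.2 (by linarith : 0 < τ + v)
  have h1 := Real.mul_self_sqrt hτ0.le
  have h2 := Real.mul_self_sqrt (by linarith : 0 ≤ τ + v)
  have hst : Real.sqrt τ ≤ Real.sqrt (τ + v) := Real.sqrt_le_sqrt (by linarith)
  have hs1 : 1 ≤ Real.sqrt τ := Real.one_le_sqrt.2 hτ
  set s := Real.sqrt τ
  set t := Real.sqrt (τ + v)
  have ht2 : t ≤ (1 + v) * s := by nlinarith
  have e1 : 1 / s - 1 / t = v / (s * t * (s + t)) := by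
    have : v = (t - s) * (t + s) := by nlinarith
    rw [this]; field_simp; ring
  rw [e1, ← h1]
  rw [div_mul_div_comm, div_le_div_iff₀ (by positivity) (by positivity)]
  have : s * t * (s + t) ≤ s * ((1 + v) * s) * (2 * ((1+v) * s)) := by
    gcongr; nlinarith
  nlinarith


/-! ### Desmoothing and iteration -/

lemma exists_weight_bound : ∃ W : ℝ, 0 < W ∧ ∀ s : Finset ℤ, ∑ k ∈ s, Real.exp (1 - |(k:ℝ)|) ≤ W := by
  have hs : Summable (fun k : ℤ => Real.exp (1 - |(k:ℝ)|)) := by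
    have h : Summable (fun n : ℕ => Real.exp (1 - (n:ℝ))) := by
      have := (Real.summable_exp_neg_nat).mul_left (Real.exp 1)
      refine this.congr fun n => ?_
      rw [← Real.exp_add]; ring_nf
    apply Summable.of_nat_of_neg
    · simpa using h
    · simpa using h
  refine ⟨∑' k : ℤ, Real.exp (1 - |(k:ℝ)|), hs.tsum_pos (fun _ => (Real.exp_pos _).le) 0 (Real.exp_pos _), fun s => ?_⟩
  exact hs.sum_le_tsum s (fun _ _ => (Real.exp_pos _).le)

lemma Phi_strict : 0 < Phi 1 - Phi (-1) := by
  have : StrictMono Phi := strictMono_of_hasDerivAt_pos Phi_hasDeriv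
    (fun x => by unfold gd; have := sqrt2pi_pos; positivity)
  have := this (show (-1:ℝ) < 1 by norm_num)
  linarith

open Classical in
lemma desmooth : ∃ C1 : ℝ, 0 < C1 ∧ ∀ (N0 : ℕ) (M : ℕ → ℝ) (δ s κ : ℝ), 0 < N0 → 0 < δ → 0 < s →
    (∀ u, |(N0 : ℝ)⁻¹ * ∑ j ∈ Finset.range N0, Phi ((u - M j) / δ) - Phi (u / s)| ≤ κ) →
    ∀ u, |(N0 : ℝ)⁻¹ * ((Finset.range N0).filter (fun j => M j ≤ u)).card - Phi (u / s)| ≤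
      κ + C1 * (δ / s + κ) := by
  obtain ⟨W, hW0, hW⟩ := exists_weight_bound
  have hc0 := Phi_strict
  set c0 := Phi 1 - Phi (-1) with hc0def
  refine ⟨c0⁻¹ * 3 * W, by positivity, ?_⟩
  intro N0 M δ s κ hN hδ hs hκ u
  have hN0 : (0:ℝ) < N0 := by exact_mod_cast hN
  have hκ0 : 0 ≤ κ := (abs_nonneg _).trans (hκ 0)
  have conc : ∀ v, ((Finset.range N0).filter (fun j => v ≤ M j ∧ M j ≤ v + δ)).card ≤
      (N0 : ℝ) * (c0⁻¹ * 3 * (δ / s + κ)) := by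
    intro v
    have h1 : c0 * ((Finset.range N0).filter (fun j => v ≤ M j ∧ M j ≤ v + δ)).card ≤
        ∑ j ∈ Finset.range N0, (Phi ((v + 2 * δ - M j) / δ) - Phi ((v - δ - M j) / δ)) := by
      calc c0 * ((Finset.range N0).filter (fun j => v ≤ M j ∧ M j ≤ v + δ)).card
          = ∑ j ∈ (Finset.range N0).filter (fun j => v ≤ M j ∧ M j ≤ v + δ), c0 := by
            rw [Finset.sum_const, nsmul_eq_mul, mul_comm]
        _ ≤ ∑ j ∈ (Finset.range N0).filter (fun j => v ≤ M j ∧ M j ≤ v + δ),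
            (Phi ((v + 2 * δ - M j) / δ) - Phi ((v - δ - M j) / δ)) := by
            apply Finset.sum_le_sum
            intro j hj
            obtain ⟨_, hj1, hj2⟩ := Finset.mem_filter.1 hj
            have a1 : Phi 1 ≤ Phi ((v + 2 * δ - M j) / δ) := by
              apply Phi_mono; rw [le_div_iff₀ hδ]; linarith
            have a2 : Phi ((v - δ - M j) / δ) ≤ Phi (-1) := by
              apply Phi_mono; rw [div_le_iff₀ hδ]; linarith
            linarith
        _ ≤ _ := by
            apply Finset.sum_le_sum_of_subset_of_nonneg (Finset.filter_subset _ _)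
            intro j _ _
            have : Phi ((v - δ - M j) / δ) ≤ Phi ((v + 2 * δ - M j) / δ) := by
              apply Phi_mono; gcongr; linarith
            linarith
    have k1 := abs_le.1 (hκ (v + 2 * δ))
    have k2 := abs_le.1 (hκ (v - δ))
    have k3 := (abs_le.1 (Phi_lip ((v + 2 * δ) / s) ((v - δ) / s))).2
    have k4 : |(v + 2 * δ) / s - (v - δ) / s| = 3 * (δ / s) := by
      rw [show (v + 2 * δ) / s - (v - δ) / s = 3 * (δ / s) by ring, abs_of_pos (by positivity)]
    rw [Finset.sum_sub_distrib] at h1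
    rw [k4] at k3
    set A := ∑ j ∈ Finset.range N0, Phi ((v + 2 * δ - M j) / δ)
    set B := ∑ j ∈ Finset.range N0, Phi ((v - δ - M j) / δ)
    have h2 : (N0 : ℝ)⁻¹ * (A - B) ≤ 3 * (δ / s + κ) := by
      have : (N0 : ℝ)⁻¹ * (A - B) = (N0 : ℝ)⁻¹ * A - (N0 : ℝ)⁻¹ * B := by ring
      linarith [k1.2, k2.1]
    have h3 : A - B ≤ N0 * (3 * (δ / s + κ)) := by
      rwa [inv_mul_le_iff₀ hN0] at h2
    have h4 := h1.trans h3
    rw [← le_inv_mul_iff₀ hc0] at h4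
    calc _ ≤ _ := h4
      _ = _ := by ring
  have tail : ∀ j, |(if M j ≤ u then (1:ℝ) else 0) - Phi ((u - M j) / δ)| ≤
      Real.exp (1 - |((⌊(M j - u) / δ⌋ : ℤ) : ℝ)|) := by
    intro j
    have f1 := Int.floor_le ((M j - u) / δ)
    have f2 := Int.lt_floor_add_one ((M j - u) / δ)
    set k : ℤ := ⌊(M j - u) / δ⌋
    have hx : (u - M j) / δ = - ((M j - u) / δ) := by ring
    rw [hx]
    set z := (M j - u) / δ with hz
    split_ifs with hj
    · have hz0 : z ≤ 0 := by
        rw [hz]; apply div_nonpos_of_nonpos_of_nonneg <;> linarith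
      rw [abs_of_nonneg (by linarith [Phi_le_one (-z)])]
      refine (one_sub_Phi_le (-z)).trans (Real.exp_le_exp.2 ?_)
      have : |(k:ℝ)| ≤ 1 - z := by rw [abs_le]; constructor <;> linarith
      linarith
    · have hz0 : 0 ≤ z := by
        rw [hz]; apply div_nonneg <;> linarith
      rw [zero_sub, abs_neg, abs_of_nonneg (Phi_nonneg _)]
      refine (Phi_le (-z)).trans (Real.exp_le_exp.2 ?_)
      have : |(k:ℝ)| ≤ 1 + z := by rw [abs_le]; constructor <;> linarith
      linarith
  have hcard : (((Finset.range N0).filter (fun j => M j ≤ u)).card : ℝ) =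
      ∑ j ∈ Finset.range N0, (if M j ≤ u then (1:ℝ) else 0) := by
    rw [Finset.sum_boole]
  have main : |(N0 : ℝ)⁻¹ * ((Finset.range N0).filter (fun j => M j ≤ u)).card -
      (N0 : ℝ)⁻¹ * ∑ j ∈ Finset.range N0, Phi ((u - M j) / δ)| ≤ c0⁻¹ * 3 * W * (δ / s + κ) := by
    rw [hcard, ← mul_sub, ← Finset.sum_sub_distrib, abs_mul, abs_of_pos (inv_pos.2 hN0),
      inv_mul_le_iff₀ hN0]
    calc _ ≤ ∑ j ∈ Finset.range N0, Real.exp (1 - |((⌊(M j - u) / δ⌋ : ℤ) : ℝ)|) :=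
          (Finset.abs_sum_le_sum_abs _ _).trans (Finset.sum_le_sum fun j _ => tail j)
      _ = ∑ k ∈ (Finset.range N0).image (fun j => ⌊(M j - u) / δ⌋),
          ((Finset.range N0).filter (fun j => ⌊(M j - u) / δ⌋ = k)).card • Real.exp (1 - |(k : ℝ)|) :=
          Finset.sum_comp (fun k : ℤ => Real.exp (1 - |(k : ℝ)|)) (fun j => ⌊(M j - u) / δ⌋)
      _ ≤ ∑ k ∈ (Finset.range N0).image (fun j => ⌊(M j - u) / δ⌋),
          ((N0 : ℝ) * (c0⁻¹ * 3 * (δ / s + κ))) * Real.exp (1 - |(k : ℝ)|) := by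
          apply Finset.sum_le_sum
          intro k _
          rw [nsmul_eq_mul]
          apply mul_le_mul_of_nonneg_right _ (Real.exp_pos _).le
          refine le_trans ?_ (conc (u + k * δ))
          norm_cast
          apply Finset.card_le_card
          intro j hj
          obtain ⟨hj0, hj1⟩ := Finset.mem_filter.1 hj
          have f1 := Int.floor_le ((M j - u) / δ)
          have f2 := Int.lt_floor_add_one ((M j - u) / δ)
          rw [hj1] at f1 f2
          rw [le_div_iff₀ hδ] at f1
          rw [div_lt_iff₀ hδ] at f2
          refine Finset.mem_filter.2 ⟨hj0, ?_, ?_⟩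
          · linarith
          · linarith
      _ ≤ ((N0 : ℝ) * (c0⁻¹ * 3 * (δ / s + κ))) * W := by
          rw [← Finset.mul_sum]
          exact mul_le_mul_of_nonneg_left (hW _) (by positivity)
      _ = _ := by ring
  have h := hκ u
  calc _ = |((N0 : ℝ)⁻¹ * ((Finset.range N0).filter (fun j => M j ≤ u)).card -
      (N0 : ℝ)⁻¹ * ∑ j ∈ Finset.range N0, Phi ((u - M j) / δ)) +
      ((N0 : ℝ)⁻¹ * ∑ j ∈ Finset.range N0, Phi ((u - M j) / δ) - Phi (u / s))| := by congr 1; ring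
    _ ≤ _ := abs_add_le _ _
    _ ≤ _ := by linarith

lemma sum_split (K N : ℕ) (a : ℕ → ℝ) :
    ∑ j ∈ Finset.range (K * N), a j = ∑ i ∈ Finset.range K, ∑ l ∈ Finset.range N, a (i + K * l) := by
  rw [Finset.sum_comm]
  induction N with
  | zero => simp
  | succ N ih =>
    rw [mul_add, mul_one, Finset.sum_range_add, ih, Finset.sum_range_succ]
    congr 1
    exact Finset.sum_congr rfl fun i _ => by rw [add_comm]

/-- Birkhoff sum along backward orbit. -/
def Sg (g m : ℝ → ℝ) (n : ℕ) (x : ℝ) : ℝ := ∑ k ∈ Finset.range n, m (g^[k+1] x)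

lemma Sg_succ (g m : ℝ → ℝ) (n : ℕ) (x : ℝ) : Sg g m (n+1) x = m (g x) + Sg g m n (g x) := by
  unfold Sg
  rw [Finset.sum_range_succ', add_comm]
  rfl

lemma g_shift {K : ℕ} {g : ℝ → ℝ} (hg1 : ∀ x, g (x + K) = g x + 1) (x : ℝ) (l : ℕ) :
    g (x + K * l) = g x + l := by
  induction l with
  | zero => simp
  | succ l ih =>
    push_cast
    rw [show x + K * ((l:ℝ) + 1) = (x + K * l) + K by ring, hg1, ih]; ring

lemma per_nat {m : ℝ → ℝ} (hm : ∀ x, m (x + 1) = m x) (x : ℝ) (l : ℕ) : m (x + l) = m x := by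
  induction l with
  | zero => simp
  | succ l ih => push_cast; rw [← add_assoc, hm, ih]

lemma iteration (K : ℕ) (hK : 1 ≤ K) (g m η : ℝ → ℝ) (hg1 : ∀ x, g (x + K) = g x + 1)
    (hmp : ∀ x, m (x + 1) = m x) (v B : ℝ) (hv : 0 < v)
    (hm : ∀ x, |m x| ≤ B) (hη : ∀ x, |η x| ≤ B)
    (hm0 : ∀ x, ∑ i ∈ Finset.range K, m (g (x + i)) = 0)
    (hme : ∀ x, (K : ℝ)⁻¹ * ∑ i ∈ Finset.range K, (m (g (x + i)) ^ 2 + η (g (x + i))) = v + η x)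
    (τ : ℝ) (hτ : 1 ≤ τ) (n : ℕ) : ∀ x u : ℝ,
    |((K : ℝ) ^ n)⁻¹ * ∑ j ∈ Finset.range (K ^ n), HH τ (η (g^[n] (x + j))) (u - Sg g m n (x + j))
      - HH (τ + n * v) (η x) u| ≤
      ((B ^ 3 + B ^ 2 + 3 * v ^ 2 + 3 * v * B) * (2 * (1 + v) ^ 2 / v)) *
        (1 / Real.sqrt τ - 1 / Real.sqrt (τ + n * v)) := by
  set D := (B ^ 3 + B ^ 2 + 3 * v ^ 2 + 3 * v * B) with hD
  have hB : 0 ≤ B := (abs_nonneg _).trans (hm 0)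
  have hD0 : 0 ≤ D := by rw [hD]; positivity
  have hK0 : (0:ℝ) < K := by exact_mod_cast hK
  induction n with
  | zero => intro x u; simp [Sg]
  | succ n ih =>
    intro x u
    have split : ((K : ℝ) ^ (n+1))⁻¹ * ∑ j ∈ Finset.range (K ^ (n+1)),
        HH τ (η (g^[n+1] (x + j))) (u - Sg g m (n+1) (x + j)) =
        (K : ℝ)⁻¹ * ∑ i ∈ Finset.range K, (((K : ℝ) ^ n)⁻¹ * ∑ l ∈ Finset.range (K ^ n),
          HH τ (η (g^[n] (g (x + i) + l))) ((u - m (g (x + i))) - Sg g m n (g (x + i) + l))) := by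
      rw [pow_succ' K n, sum_split, ← Finset.mul_sum, ← mul_assoc, ← mul_inv, pow_succ' (K:ℝ) n]
      congr 1
      refine Finset.sum_congr rfl fun i _ => Finset.sum_congr rfl fun l _ => ?_
      have e : g (x + ((i + K * l : ℕ) : ℝ)) = g (x + i) + l := by
        push_cast
        rw [← add_assoc, g_shift hg1]
      rw [Function.iterate_succ_apply, Sg_succ, e, per_nat hmp]
      congr 1; ring
    rw [split]
    have hτn : 1 ≤ τ + n * v := by
      have : 0 ≤ (n:ℝ) * v := by positivity
      linarith
    have st := one_step K hK (fun i => m (g (x + i))) (fun i => η (g (x + i))) (η x) v B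
      (τ + n * v) u hv.le hτn (fun i => hm _) (fun i => hη _) (hη x) (hm0 x) (hme x)
    have pt := potential v (τ + n * v) hv hτn
    have e2 : τ + ((n + 1 : ℕ) : ℝ) * v = τ + n * v + v := by push_cast; ring
    rw [e2]
    have av : |(K : ℝ)⁻¹ * ∑ i ∈ Finset.range K, (((K : ℝ) ^ n)⁻¹ * ∑ l ∈ Finset.range (K ^ n),
          HH τ (η (g^[n] (g (x + i) + l))) ((u - m (g (x + i))) - Sg g m n (g (x + i) + l))) -
        (K : ℝ)⁻¹ * ∑ i ∈ Finset.range K, HH (τ + n * v) (η (g (x + i))) (u - m (g (x + i)))| ≤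
        (D * (2 * (1 + v) ^ 2 / v)) * (1 / Real.sqrt τ - 1 / Real.sqrt (τ + n * v)) := by
      rw [← mul_sub, ← Finset.sum_sub_distrib, abs_mul, abs_of_pos (inv_pos.2 hK0),
        inv_mul_le_iff₀ hK0]
      refine (Finset.abs_sum_le_sum_abs _ _).trans ?_
      refine (Finset.sum_le_sum fun (i : ℕ) _ => ih (g (x + (i : ℝ))) (u - m (g (x + i)))).trans ?_
      simp
    rw [← hD] at st
    have st2 := st.trans (mul_le_mul_of_nonneg_left pt hD0)
    calc _ = |_ + _| := by congr 1; exact (sub_add_sub_cancel _ _ _).symm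
      _ ≤ _ := abs_add_le _ _
      _ ≤ _ := add_le_add av st2
      _ = _ := by ring

open Classical in
lemma clt (K : ℕ) (hK : 1 ≤ K) (g m η : ℝ → ℝ) (hg1 : ∀ x, g (x + K) = g x + 1)
    (hmp : ∀ x, m (x + 1) = m x) (v B : ℝ) (hv : 0 < v)
    (hm : ∀ x, |m x| ≤ B) (hη : ∀ x, |η x| ≤ B)
    (hm0 : ∀ x, ∑ i ∈ Finset.range K, m (g (x + i)) = 0)
    (hme : ∀ x, (K : ℝ)⁻¹ * ∑ i ∈ Finset.range K, (m (g (x + i)) ^ 2 + η (g (x + i))) = v + η x) :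
    ∃ C : ℝ, 0 < C ∧ ∀ n : ℕ, 1 ≤ n → ∀ x u : ℝ,
      |((K : ℝ) ^ n)⁻¹ * ((Finset.range (K ^ n)).filter (fun j : ℕ => Sg g m n (x + j) ≤ u)).card -
        Phi (u / (Real.sqrt v * Real.sqrt n))| ≤ C / (n : ℝ) ^ ((1:ℝ) / 4) := by
  obtain ⟨C1, hC1, hdes⟩ := desmooth
  have hB : 0 ≤ B := (abs_nonneg _).trans (hm 0)
  set E := ((B ^ 3 + B ^ 2 + 3 * v ^ 2 + 3 * v * B) * (2 * (1 + v) ^ 2 / v)) with hE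
  have hE0 : 0 ≤ E := by rw [hE]; positivity
  have hsv := Real.sqrt_pos.2 hv
  set κ0 := E + 2 * B + 1 / v with hκ0
  have hκ0' : 0 < κ0 := by rw [hκ0]; positivity
  refine ⟨κ0 + C1 * (1 / Real.sqrt v + κ0), by positivity, ?_⟩
  intro n hn x u
  have hn1 : (1:ℝ) ≤ n := by exact_mod_cast hn
  set q := (n : ℝ) ^ ((1:ℝ) / 4) with hq
  have hq1 : 1 ≤ q := Real.one_le_rpow hn1 (by norm_num)
  have hq0 : 0 < q := by linarith
  have hq4 : q ^ 4 = n := by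
    rw [hq, ← Real.rpow_natCast, ← Real.rpow_mul (by linarith)]; norm_num
  have hsn : Real.sqrt n = q ^ 2 := by
    rw [← hq4, show q ^ 4 = (q ^ 2) ^ 2 by ring, Real.sqrt_sq (by positivity)]
  have hK0 : (0:ℝ) < K := by exact_mod_cast hK
  have hKn : 0 < K ^ n := by positivity
  have hq2 : 1 ≤ q ^ 2 := one_le_pow₀ hq1
  have inv2 : 1 / q ^ 2 ≤ 1 / q := by
    apply one_div_le_one_div_of_le hq0; nlinarith
  have key : ∀ w, |((K ^ n : ℕ) : ℝ)⁻¹ * ∑ j ∈ Finset.range (K ^ n), Phi ((w - Sg g m n (x + j)) / q)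
      - Phi (w / (Real.sqrt v * Real.sqrt n))| ≤ κ0 / q := by
    intro w
    have it := iteration K hK g m η hg1 hmp v B hv hm hη hm0 hme (q ^ 2) hq2 n x w
    rw [← hE, Real.sqrt_sq hq0.le] at it
    have it1 : E * (1 / q - 1 / Real.sqrt (q ^ 2 + n * v)) ≤ E * (1 / q) := by
      gcongr
      have : 0 ≤ 1 / Real.sqrt (q ^ 2 + n * v) := by positivity
      linarith
    have hnn : ∀ w, NN (q ^ 2) w = Phi (w / q) := fun w => by
      unfold NN; rw [Real.sqrt_sq hq0.le]
    have a1 : |((K ^ n : ℕ) : ℝ)⁻¹ * ∑ j ∈ Finset.range (K ^ n), Phi ((w - Sg g m n (x + j)) / q) -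
        ((K : ℝ) ^ n)⁻¹ * ∑ j ∈ Finset.range (K ^ n),
          HH (q ^ 2) (η (g^[n] (x + j))) (w - Sg g m n (x + j))| ≤ B * (1 / q) := by
      rw [Nat.cast_pow, ← mul_sub, ← Finset.sum_sub_distrib, abs_mul,
        abs_of_pos (by positivity), inv_mul_le_iff₀ (by positivity)]
      refine (Finset.abs_sum_le_sum_abs _ _).trans ?_
      calc _ ≤ ∑ j ∈ Finset.range (K ^ n), B * (1 / q) := by
            apply Finset.sum_le_sum
            intro j _
            unfold HH
            rw [hnn, sub_add_cancel_left, abs_neg, abs_mul, abs_div, abs_two]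
            have h1 := NNuu_bound (q ^ 2) (w - Sg g m n (x + j)) (by positivity)
            have h2 := abs_nonneg (NNuu (q ^ 2) (w - Sg g m n (x + j)))
            calc _ ≤ (1 / q) * B := mul_le_mul (by linarith) (hη _) (abs_nonneg _) (by positivity)
              _ = _ := by ring
        _ = _ := by simp
    have hnv : 0 < (n:ℝ) * v := by positivity
    have hnv2 : 0 < q ^ 2 + (n:ℝ) * v := by positivity
    have a2 : |HH (q ^ 2 + n * v) (η x) w - NN (q ^ 2 + n * v) w| ≤ B * (1 / q) := by
      unfold HH
      rw [add_sub_cancel_left, abs_mul, abs_div, abs_two]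
      have h1 := NNuu_bound (q ^ 2 + n * v) w hnv2
      have h2 := abs_nonneg (NNuu (q ^ 2 + n * v) w)
      have h3 : 1 / (q ^ 2 + n * v) ≤ 1 / q ^ 2 := by gcongr; linarith
      calc _ ≤ (1 / q) * B := mul_le_mul (by linarith) (hη _) (abs_nonneg _) (by positivity)
        _ = _ := by ring
    have a3 : |NN (q ^ 2 + n * v) w - Phi (w / (Real.sqrt v * Real.sqrt n))| ≤ 1 / v * (1 / q) := by
      have h1 := NN_tlip (n * v) (q ^ 2) w hnv (by positivity)
      have h2 : NN (n * v) w = Phi (w / (Real.sqrt v * Real.sqrt n)) := by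
        unfold NN; rw [mul_comm (n:ℝ) v, Real.sqrt_mul hv.le]
      rw [add_comm, ← h2]
      refine h1.trans ?_
      rw [← hq4]
      calc 1 / (q ^ 4 * v) * q ^ 2 = 1 / v * (1 / q ^ 2) := by field_simp
        _ ≤ _ := by gcongr
    have a0 := it.trans it1
    have hk : κ0 / q = (B * (1 / q) + E * (1 / q)) + (B * (1 / q) + 1 / v * (1 / q)) := by
      rw [hκ0]; ring
    rw [hk]
    rw [abs_le] at a0 a1 a2 a3 ⊢
    constructor <;> linarith [a0.1, a0.2, a1.1, a1.2, a2.1, a2.2, a3.1, a3.2]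
  have fin := hdes (K ^ n) (fun j => Sg g m n (x + j)) q (Real.sqrt v * Real.sqrt n) (κ0 / q) hKn hq0
    (by rw [hsn]; positivity) key u
  rw [Nat.cast_pow] at fin
  refine fin.trans ?_
  have : q / (Real.sqrt v * Real.sqrt n) = (1 / Real.sqrt v) / q := by
    rw [hsn]; field_simp
  rw [this]
  apply le_of_eq
  ring


/-! ### Transfer operator on periodic Lipschitz functions -/

def Lop (K : ℕ) (g : ℝ → ℝ) (φ : ℝ → ℝ) (x : ℝ) : ℝ :=
  (K : ℝ)⁻¹ * ∑ i ∈ Finset.range K, φ (g (x + i))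

lemma Lop_apply (K : ℕ) (g φ : ℝ → ℝ) (x : ℝ) :
    Lop K g φ x = (K : ℝ)⁻¹ * ∑ i ∈ Finset.range K, φ (g (x + i)) := rfl

structure LP (A : ℝ) (φ : ℝ → ℝ) : Prop where
  per : ∀ x, φ (x + 1) = φ x
  lip : ∀ x y, |φ x - φ y| ≤ A * |x - y|

structure Sys (K : ℕ) (F g : ℝ → ℝ) (r LF : ℝ) (I : (ℝ → ℝ) → ℝ) : Prop where
  hK : 1 ≤ K
  hr0 : 0 ≤ r
  hr1 : r < 1
  hFg : ∀ x, F (g x) = x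
  hgF : ∀ x, g (F x) = x
  hg1 : ∀ x, g (x + K) = g x + 1
  hF1 : ∀ x, F (x + 1) = F x + K
  hgL : ∀ x y, |g x - g y| ≤ r * |x - y|
  hFL : ∀ x y, |F x - F y| ≤ LF * |x - y|
  hI_ge : ∀ φ c, Continuous φ → (∀ x, φ (x + 1) = φ x) → (∀ x, c ≤ φ x) → c ≤ I φ
  hI_le : ∀ φ c, Continuous φ → (∀ x, φ (x + 1) = φ x) → (∀ x, φ x ≤ c) → I φ ≤ c
  hI_L : ∀ φ, Continuous φ → (∀ x, φ (x + 1) = φ x) → I (Lop K g φ) = I φ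
  hI_sub : ∀ φ c, Continuous φ → (∀ x, φ (x + 1) = φ x) → I (fun x => φ x - c) = I φ - c

lemma LP.nonneg {A : ℝ} {φ : ℝ → ℝ} (h : LP A φ) : 0 ≤ A := by
  have := h.lip 1 0
  simp at this
  exact (abs_nonneg _).trans this

lemma LP.cont {A : ℝ} {φ : ℝ → ℝ} (h : LP A φ) : Continuous φ := by
  have : LipschitzWith (Real.toNNReal A) φ := by
    apply LipschitzWith.of_dist_le_mul
    intro x y
    rw [Real.dist_eq, Real.dist_eq, Real.coe_toNNReal _ h.nonneg]
    exact h.lip x y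
  exact this.continuous

lemma per_int {φ : ℝ → ℝ} (h : ∀ x, φ (x + 1) = φ x) (x : ℝ) (l : ℤ) : φ (x + l) = φ x := by
  have hp : Function.Periodic φ 1 := h
  have := hp.int_mul l x
  simpa using this

lemma LP.osc {A : ℝ} {φ : ℝ → ℝ} (h : LP A φ) (x y : ℝ) : |φ x - φ y| ≤ A := by
  have e : φ (x + Int.fract (y - x)) = φ y := by
    have := per_int h.per (x + Int.fract (y - x)) ⌊y - x⌋
    rw [← this]; congr 1
    have := Int.fract_add_floor (y - x)
    linarith
  rw [← e]
  refine (h.lip _ _).trans ?_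
  have h1 : |x - (x + Int.fract (y - x))| ≤ 1 := by
    rw [sub_add_cancel_left, abs_neg, abs_of_nonneg (Int.fract_nonneg _)]
    exact (Int.fract_lt_one _).le
  nlinarith [h.nonneg]

lemma LP.bdd {A : ℝ} {φ : ℝ → ℝ} (h : LP A φ) (x : ℝ) : |φ x| ≤ |φ 0| + A := by
  have h1 := h.osc x 0
  have h2 := abs_add_le (φ x - φ 0) (φ 0)
  rw [sub_add_cancel] at h2
  linarith

lemma LP.mono {A B : ℝ} {φ : ℝ → ℝ} (h : LP A φ) (hAB : A ≤ B) : LP B φ :=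
  ⟨h.per, fun x y => (h.lip x y).trans (by gcongr)⟩

lemma LP.sq {A : ℝ} {φ : ℝ → ℝ} (h : LP A φ) : LP (2 * (|φ 0| + A) * A) (fun x => φ x ^ 2) := by
  refine ⟨fun x => by simp only [h.per], fun x y => ?_⟩
  rw [show φ x ^ 2 - φ y ^ 2 = (φ x + φ y) * (φ x - φ y) by ring, abs_mul]
  have h1 : |φ x + φ y| ≤ 2 * (|φ 0| + A) := by
    have := abs_add_le (φ x) (φ y); have := h.bdd x; have := h.bdd y; linarith
  rw [mul_assoc (2 * (|φ 0| + A)) A]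
  have := h.nonneg
  exact mul_le_mul h1 (h.lip x y) (abs_nonneg _) (by positivity)

lemma LP.sub_const {A : ℝ} {φ : ℝ → ℝ} (h : LP A φ) (c : ℝ) : LP A (fun x => φ x - c) :=
  ⟨fun x => by simp only [h.per], fun x y => by
    rw [sub_sub_sub_cancel_right]; exact h.lip x y⟩

section
variable {K : ℕ} {F g : ℝ → ℝ} {r LF : ℝ} {I : (ℝ → ℝ) → ℝ}

lemma Lop_per (S : Sys K F g r LF I) {φ : ℝ → ℝ} (h : ∀ x, φ (x + 1) = φ x) (x : ℝ) :
    Lop K g φ (x + 1) = Lop K g φ x := by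
  unfold Lop
  congr 1
  have h1 := Finset.sum_range_succ (fun i : ℕ => φ (g (x + i))) K
  have h2 := Finset.sum_range_succ' (fun i : ℕ => φ (g (x + i))) K
  simp only [S.hg1, h] at h1
  simp only [Nat.cast_zero, add_zero] at h2
  have : ∑ i ∈ Finset.range K, φ (g (x + 1 + i)) = ∑ i ∈ Finset.range K, φ (g (x + ((i + 1 : ℕ) : ℝ))) := by
    refine Finset.sum_congr rfl fun i _ => ?_
    congr 2; push_cast; ring
  linarith

lemma LP.op (S : Sys K F g r LF I) {A : ℝ} {φ : ℝ → ℝ} (h : LP A φ) : LP (A * r) (Lop K g φ) := by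
  have hK0 : (0:ℝ) < K := by exact_mod_cast S.hK
  refine ⟨Lop_per S h.per, fun x y => ?_⟩
  unfold Lop
  rw [← mul_sub, ← Finset.sum_sub_distrib, abs_mul, abs_of_pos (inv_pos.2 hK0), inv_mul_le_iff₀ hK0]
  refine (Finset.abs_sum_le_sum_abs _ _).trans ?_
  calc _ ≤ ∑ i ∈ Finset.range K, A * r * |x - y| := by
        apply Finset.sum_le_sum
        intro i _
        refine (h.lip _ _).trans ?_
        rw [mul_assoc]
        apply mul_le_mul_of_nonneg_left _ h.nonneg
        have := S.hgL (x + i) (y + i)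
        rwa [add_sub_add_right_eq_sub] at this
    _ = _ := by simp

lemma LP.near (S : Sys K F g r LF I) {A : ℝ} {φ : ℝ → ℝ} (h : LP A φ) (x : ℝ) : |φ x - I φ| ≤ A := by
  rw [abs_le]
  have h1 := S.hI_ge φ (φ x - A) h.cont h.per (fun y => by have := (abs_le.1 (h.osc x y)).2; linarith)
  have h2 := S.hI_le φ (φ x + A) h.cont h.per (fun y => by have := (abs_le.1 (h.osc x y)).1; linarith)
  constructor <;> linarith

lemma LP.iter (S : Sys K F g r LF I) {A : ℝ} {φ : ℝ → ℝ} (h : LP A φ) (n : ℕ) :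
    LP (A * r ^ n) ((Lop K g)^[n] φ) ∧ I ((Lop K g)^[n] φ) = I φ := by
  induction n with
  | zero => simpa using h
  | succ n ih =>
    rw [Function.iterate_succ_apply', pow_succ, ← mul_assoc]
    exact ⟨ih.1.op S, by rw [S.hI_L _ ih.1.cont ih.1.per, ih.2]⟩

lemma poisson (S : Sys K F g r LF I) {A : ℝ} {q : ℝ → ℝ} (h : LP A q) (hq : I q = 0) :
    ∃ θ B, LP B θ ∧ ∀ x, θ x - Lop K g θ x = q x := by
  have hb : ∀ n x, |(Lop K g)^[n] q x| ≤ A * r ^ n := by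
    intro n x
    have := (h.iter S n).1.near S x
    rwa [(h.iter S n).2, hq, sub_zero] at this
  have hgeo : Summable (fun n : ℕ => A * r ^ n) :=
    (summable_geometric_of_lt_one S.hr0 S.hr1).mul_left A
  have hs : ∀ x, Summable (fun n : ℕ => (Lop K g)^[n] q x) := fun x =>
    Summable.of_norm_bounded hgeo (fun n => hb n x)
  refine ⟨fun x => ∑' n : ℕ, (Lop K g)^[n] q x, ∑' n : ℕ, A * r ^ n, ⟨?_, ?_⟩, ?_⟩
  · intro x
    exact tsum_congr fun n => (h.iter S n).1.per x
  · intro x y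
    rw [← (hs x).tsum_sub (hs y), ← tsum_mul_right]
    have := tsum_of_norm_bounded (hgeo.mul_right |x - y|).hasSum
      (f := fun n : ℕ => (Lop K g)^[n] q x - (Lop K g)^[n] q y) (fun n => (h.iter S n).1.lip x y)
    exact this
  · intro x
    have e : Lop K g (fun x => ∑' n : ℕ, (Lop K g)^[n] q x) x = ∑' n : ℕ, (Lop K g)^[n+1] q x := by
      rw [Lop_apply]
      rw [← Summable.tsum_finsetSum (fun i _ => hs _), ← tsum_mul_left]
      refine tsum_congr fun n => ?_
      rw [Function.iterate_succ_apply']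
      rfl
    rw [e]
    have := (hs x).tsum_eq_zero_add
    simp only [Function.iterate_zero, id] at this
    simp only
    rw [this]; ring

lemma F_nat (S : Sys K F g r LF I) (x : ℝ) : ∀ φ : ℝ → ℝ, (∀ x, φ (x + 1) = φ x) → φ (F (x + 1)) = φ (F x) := by
  intro φ h
  rw [S.hF1, per_nat h]

lemma Lop_iter_ge (S : Sys K F g r LF I) {φ : ℝ → ℝ} (h0 : ∀ x, 0 ≤ φ x) (n : ℕ) :
    ∀ x, 0 ≤ (Lop K g)^[n] φ x ∧ ((K:ℝ) ^ n)⁻¹ * φ (g^[n] x) ≤ (Lop K g)^[n] φ x := by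
  have hK0 : (0:ℝ) < K := by exact_mod_cast S.hK
  induction n with
  | zero => intro x; simp [h0 x]
  | succ n ih =>
    intro x
    rw [Function.iterate_succ_apply']
    have h1 : (K:ℝ)⁻¹ * (Lop K g)^[n] φ (g x) ≤ Lop K g ((Lop K g)^[n] φ) x := by
      rw [Lop_apply K g ((Lop K g)^[n] φ)]
      gcongr
      have := Finset.single_le_sum (f := fun i : ℕ => (Lop K g)^[n] φ (g (x + i)))
        (s := Finset.range K) (fun i _ => (ih _).1) (Finset.mem_range.2 S.hK)
      simpa using this
    refine ⟨le_trans (mul_nonneg (by positivity) (ih _).1) h1, le_trans ?_ h1⟩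
    rw [Function.iterate_succ_apply, pow_succ', mul_inv, mul_assoc]
    gcongr
    exact (ih _).2

lemma g_iter_lip (S : Sys K F g r LF I) (n : ℕ) (x y : ℝ) : |g^[n] x - g^[n] y| ≤ r ^ n * |x - y| := by
  induction n with
  | zero => simp
  | succ n ih =>
    rw [Function.iterate_succ_apply', Function.iterate_succ_apply', pow_succ', mul_assoc]
    exact (S.hgL _ _).trans (mul_le_mul_of_nonneg_left ih S.hr0)

lemma I_pos (S : Sys K F g r LF I) {A : ℝ} {φ : ℝ → ℝ} (h : LP A φ) (h0 : ∀ x, 0 ≤ φ x) (x0 : ℝ)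
    (hx0 : 0 < φ x0) : 0 < I φ := by
  have hK0 : (0:ℝ) < K := by exact_mod_cast S.hK
  have hlim : Tendsto (fun n : ℕ => A * r ^ n) atTop (nhds (A * 0)) :=
    (tendsto_pow_atTop_nhds_zero_of_lt_one S.hr0 S.hr1).const_mul A
  rw [mul_zero] at hlim
  obtain ⟨n, hn⟩ := (hlim.eventually (gt_mem_nhds (half_pos hx0))).exists
  rw [← (h.iter S n).2]
  have hpos : 0 < ((K:ℝ) ^ n)⁻¹ * (φ x0 / 2) := by positivity
  refine lt_of_lt_of_le hpos ?_
  apply S.hI_ge _ _ (h.iter S n).1.cont (h.iter S n).1.per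
  intro x
  set z := F^[n] x0
  have hz : g^[n] z = x0 := (Function.LeftInverse.iterate S.hgF n) x0
  set x' := z + Int.fract (x - z)
  have e : (Lop K g)^[n] φ x' = (Lop K g)^[n] φ x := by
    rw [← per_int (h.iter S n).1.per x' ⌊x - z⌋]
    have h5 := Int.fract_add_floor (x - z)
    have h6 : x' + (⌊x - z⌋ : ℝ) = x := by simp only [x']; linarith
    rw [h6]
  rw [← e]
  refine le_trans ?_ (Lop_iter_ge S h0 n x').2
  gcongr
  have h1 := g_iter_lip S n z x'
  have h2 : |z - x'| ≤ 1 := by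
    simp only [x']
    rw [sub_add_cancel_left, abs_neg, abs_of_nonneg (Int.fract_nonneg _)]
    exact (Int.fract_lt_one _).le
  have h3 := (abs_le.1 (h.lip (g^[n] z) (g^[n] x'))).2
  have h4 : A * |g^[n] z - g^[n] x'| ≤ A * r ^ n := by
    apply mul_le_mul_of_nonneg_left _ h.nonneg
    refine h1.trans ?_
    have := pow_nonneg S.hr0 n
    nlinarith
  rw [hz] at h3 h4
  linarith

lemma decomposition (S : Sys K F g r LF I) {A : ℝ} {h : ℝ → ℝ} (hh : LP A h) :
    ∃ (ψ m η : ℝ → ℝ) (v B A' : ℝ), LP A' ψ ∧ (∀ x, m x = h x - I h + ψ x - ψ (F x)) ∧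
      (∀ x, m (x + 1) = m x) ∧ 0 ≤ v ∧ (∀ x, |m x| ≤ B) ∧ (∀ x, |η x| ≤ B) ∧ (∀ x, |ψ x| ≤ B) ∧
      (∀ x, ∑ i ∈ Finset.range K, m (g (x + i)) = 0) ∧
      (∀ x, (K : ℝ)⁻¹ * ∑ i ∈ Finset.range K, (m (g (x + i)) ^ 2 + η (g (x + i))) = v + η x) ∧
      (v = 0 → ∀ x, m x = 0) := by
  have hK0 : (0:ℝ) < K := by exact_mod_cast S.hK
  obtain ⟨θ, B1, hθ, hθq⟩ := poisson S (hh.sub_const (I h)) (by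
    rw [S.hI_sub h _ hh.cont hh.per, sub_self])
  have hψ := hθ.op S
  set ψ := Lop K g θ with hψdef
  set m : ℝ → ℝ := fun x => h x - I h + ψ x - ψ (F x) with hm
  have hmθ : ∀ x, m x = θ x - ψ (F x) := fun x => by
    have := hθq x; simp only [hm]; linarith
  have hmLP : LP (B1 + B1 * r * LF) m := by
    refine ⟨fun x => ?_, fun x y => ?_⟩
    · rw [hmθ, hmθ, hθ.per, F_nat S x ψ hψ.per]
    · rw [hmθ, hmθ, show θ x - ψ (F x) - (θ y - ψ (F y)) = (θ x - θ y) - (ψ (F x) - ψ (F y)) by ring]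
      refine (abs_sub _ _).trans ?_
      have h1 := hθ.lip x y
      have h2 := hψ.lip (F x) (F y)
      have h3 := mul_le_mul_of_nonneg_left (S.hFL x y) hψ.nonneg
      nlinarith
  have hm2 := hmLP.sq
  set v := I (fun x => m x ^ 2) with hv
  obtain ⟨η, B2, hη, hηq⟩ := poisson S ((hm2.op S).sub_const v) (by
    rw [S.hI_sub _ _ (hm2.op S).cont (hm2.op S).per, S.hI_L _ hm2.cont hm2.per, ← hv, sub_self])
  refine ⟨ψ, m, η, v, max (|m 0| + (B1 + B1 * r * LF)) (max (|η 0| + B2) (|ψ 0| + B1 * r)), B1 * r,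
    hψ, fun x => rfl, hmLP.per, ?_, ?_, ?_, ?_, ?_, ?_, ?_⟩
  · exact S.hI_ge _ _ hm2.cont hm2.per fun x => sq_nonneg _
  · exact fun x => (hmLP.bdd x).trans (le_max_left _ _)
  · exact fun x => (hη.bdd x).trans ((le_max_left _ _).trans (le_max_right _ _))
  · exact fun x => (hψ.bdd x).trans ((le_max_right _ _).trans (le_max_right _ _))
  · intro x
    have e : ∀ i : ℕ, m (g (x + i)) = θ (g (x + i)) - ψ x := fun i => by
      rw [hmθ, S.hFg, per_nat hψ.per]
    simp only [e]
    rw [Finset.sum_sub_distrib]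
    have : ψ x = (K:ℝ)⁻¹ * ∑ i ∈ Finset.range K, θ (g (x + i)) := rfl
    rw [this]
    simp
    field_simp
    ring
  · intro x
    have := hηq x
    rw [Finset.sum_add_distrib, mul_add]
    unfold Lop at this
    linarith
  · intro hv0 x
    by_contra hne
    have := I_pos S hm2 (fun x => sq_nonneg _) x (by positivity)
    rw [← hv] at this
    linarith

end


/-! ### The concrete system -/

lemma coe_eq_iff (x y : ℝ) : (x : AddCircle (1:ℝ)) = y ↔ ∃ l : ℤ, x = y + l := by
  rw [← sub_eq_zero, ← AddCircle.coe_sub, AddCircle.coe_eq_zero_iff]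
  constructor
  · rintro ⟨n, hn⟩; exact ⟨n, by simp at hn; linarith⟩
  · rintro ⟨n, hn⟩; exact ⟨n, by simp; linarith⟩

lemma coe_add_int (x : ℝ) (l : ℤ) : ((x + l : ℝ) : AddCircle (1:ℝ)) = x :=
  (coe_eq_iff _ _).2 ⟨l, rfl⟩

def rep (p : AddCircle (1:ℝ)) : ℝ := Quotient.out p

lemma coe_rep (p : AddCircle (1:ℝ)) : ((rep p : ℝ) : AddCircle (1:ℝ)) = p := Quotient.out_eq p

lemma rep_coe (x : ℝ) : ∃ l : ℤ, rep (x : AddCircle (1:ℝ)) = x + l :=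
  (coe_eq_iff _ _).1 (coe_rep _)

lemma per_rep {φ : ℝ → ℝ} (h : ∀ x, φ (x + 1) = φ x) (x : ℝ) : φ (rep (x : AddCircle (1:ℝ))) = φ x := by
  obtain ⟨l, hl⟩ := rep_coe x
  rw [hl, per_int h]

lemma cont_rep {φ : ℝ → ℝ} (hc : Continuous φ) (h : ∀ x, φ (x + 1) = φ x) :
    Continuous (fun p => φ (rep p)) := by
  have hq : Topology.IsQuotientMap (fun x : ℝ => (x : AddCircle (1:ℝ))) := isQuotientMap_quotient_mk'
  rw [hq.continuous_iff]
  have : (fun p => φ (rep p)) ∘ (fun x : ℝ => (x : AddCircle (1:ℝ))) = φ := by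
    ext x; exact per_rep h x
  rw [this]; exact hc

lemma per_bdd {φ : ℝ → ℝ} (hc : Continuous φ) (h : ∀ x, φ (x + 1) = φ x) : ∃ B, ∀ x, |φ x| ≤ B := by
  obtain ⟨B, hB⟩ := isCompact_Icc.exists_bound_of_continuousOn (s := Set.Icc (0:ℝ) 1) hc.continuousOn
  refine ⟨B, fun x => ?_⟩
  have e : φ x = φ (Int.fract x) := by
    have := per_int h (Int.fract x) ⌊x⌋
    rw [Int.fract_add_floor] at this
    exact this
  rw [e]
  exact hB _ ⟨Int.fract_nonneg _, (Int.fract_lt_one _).le⟩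

lemma lip_of_c1 {φ : ℝ → ℝ} (hc : ContDiff ℝ 1 φ) (h : ∀ x, deriv φ (x + 1) = deriv φ x) :
    ∃ A, ∀ x y, |φ x - φ y| ≤ A * |x - y| := by
  obtain ⟨B, hB⟩ := per_bdd (hc.continuous_deriv le_rfl) h
  refine ⟨B, fun x y => ?_⟩
  have := Convex.norm_image_sub_le_of_norm_deriv_le (f := φ) (C := B) (s := Set.univ) (x := y) (y := x)
    (fun z _ => (hc.differentiable (by norm_num)).differentiableAt) (fun z _ => hB z) convex_univ
    (Set.mem_univ _) (Set.mem_univ _)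
  simpa using this

lemma deriv_shift {φ : ℝ → ℝ} {c : ℝ} (h : ∀ x, φ (x + 1) = φ x + c) (x : ℝ) :
    deriv φ (x + 1) = deriv φ x := by
  have h1 : (fun x => φ (x + 1)) = fun x => φ x + c := funext h
  have h2 := deriv_comp_add_const φ 1 x
  rw [h1, deriv_add_const] at h2
  exact h2.symm

/-- Continuous maps which expand are bijective. -/
lemma expand_surj {T : ℝ → ℝ} (hc : Continuous T) (c : ℝ) (hcp : 0 < c)
    (h : ∀ x y, x ≤ y → c * (y - x) ≤ T y - T x) : Function.Surjective T ∧ StrictMono T := by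
  constructor
  · apply hc.surjective
    · refine tendsto_atTop_mono' (f₁ := fun x => c * x + T 0) atTop ?_ ?_
      · filter_upwards [eventually_ge_atTop 0] with x hx
        have := h 0 x hx; linarith
      · exact tendsto_atTop_add_const_right _ _ (tendsto_id.const_mul_atTop hcp)
    · refine tendsto_atBot_mono' (f₁ := fun x => c * x + T 0) atBot ?_ ?_
      · filter_upwards [eventually_le_atBot 0] with x hx
        have := h x 0 hx; linarith
      · exact tendsto_atBot_add_const_right _ _ (tendsto_id.const_mul_atBot hcp)
  · intro x y hxy
    have := h x y hxy.le
    have : 0 < c * (y - x) := mul_pos hcp (by linarith)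
    linarith

lemma expand_of_deriv {T : ℝ → ℝ} (hd : Differentiable ℝ T) (c : ℝ) (h : ∀ x, c ≤ deriv T x) :
    ∀ x y, x ≤ y → c * (y - x) ≤ T y - T x := fun x y hxy =>
  mul_sub_le_image_sub_of_le_deriv hd h hxy

lemma F_int {K : ℕ} {F : ℝ → ℝ} (hdeg : ∀ x : ℝ, F (x + 1) = F x + K) (x : ℝ) (l : ℤ) :
    F (x + l) = F x + K * l := by
  have := per_int (φ := fun x => F x - K * x) (fun x => by rw [hdeg]; ring) x l
  linarith

lemma smooth_conj (K : ℕ) (F : ℝ → ℝ) (hF : ContDiff ℝ 2 F)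
    (hdeg : ∀ x : ℝ, F (x + 1) = F x + K) (hpos : ∀ x, 0 < deriv F x)
    (f : AddCircle (1:ℝ) → AddCircle (1:ℝ))
    (hfF : ∀ x : ℝ, f (x : AddCircle (1:ℝ)) = ((F x : ℝ) : AddCircle (1:ℝ)))
    (p : ℝ) (hp : F p = p) (ψ : ℝ → ℝ) (hψc : Continuous ψ) (hψ : ∀ x, ψ (x + 1) = ψ x) (c : ℝ)
    (hcoh : ∀ x, Real.log (deriv F x) - c + ψ x - ψ (F x) = 0) : SmoothConj K f := by
  set w : ℝ → ℝ := fun x => Real.exp (- ψ x) with hw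
  have hwc : Continuous w := by fun_prop
  have hwp : ∀ x, w (x + 1) = w x := fun x => by simp only [hw, hψ]
  obtain ⟨B, hB⟩ := per_bdd hψc hψ
  have hwB : ∀ x, Real.exp (-B) ≤ w x := fun x => by
    apply Real.exp_le_exp.2; have := (abs_le.1 (hB x)).2; linarith
  set Z := ∫ t in (0:ℝ)..1, w t with hZ
  have hZ0 : 0 < Z := intervalIntegral.intervalIntegral_pos_of_pos (hwc.intervalIntegrable _ _)
    (fun x => Real.exp_pos _) (by norm_num)
  set U : ℝ → ℝ := fun x => Z⁻¹ * ∫ t in p..x, w t with hU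
  have hUd : ∀ x, HasDerivAt U (Z⁻¹ * w x) x := fun x =>
    (intervalIntegral.integral_hasDerivAt_right (hwc.intervalIntegrable _ _)
      hwc.stronglyMeasurable.stronglyMeasurableAtFilter hwc.continuousAt).const_mul _
  have hU1 : ∀ x, U (x + 1) = U x + 1 := by
    intro x
    have h1 : ∫ t in x..(x+1), w t = Z := by
      have := Function.Periodic.intervalIntegral_add_eq (f := w) (T := 1) hwp x 0
      rw [this, zero_add]
    have h2 := intervalIntegral.integral_add_adjacent_intervals (hwc.intervalIntegrable (μ := volume) p x)
      (hwc.intervalIntegrable x (x+1))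
    simp only [hU]
    rw [← h2, h1]
    field_simp
  have hUp : U p = 0 := by simp [hU]
  have hUdiff : Differentiable ℝ U := fun x => (hUd x).differentiableAt
  have hUderiv : deriv U = fun x => Z⁻¹ * w x := funext fun x => (hUd x).deriv
  obtain ⟨hUs, hUm⟩ := expand_surj hUdiff.continuous (Z⁻¹ * Real.exp (-B)) (by positivity)
    (expand_of_deriv hUdiff _ (fun x => by
      rw [hUderiv]; simp only
      exact mul_le_mul_of_nonneg_left (hwB x) (by positivity)))
  have hFd : Differentiable ℝ F := hF.differentiable (by norm_num)
  have hUF : ∀ x, U (F x) = Real.exp c * U x := by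
    intro x
    have hd : ∀ x, HasDerivAt (fun x => U (F x) - Real.exp c * U x) 0 x := by
      intro x
      have := ((hUd (F x)).comp x (hFd x).hasDerivAt).sub ((hUd x).const_mul (Real.exp c))
      refine this.congr_deriv ?_
      have h1 : deriv F x = Real.exp (c - ψ x + ψ (F x)) := by
        rw [← Real.exp_log (hpos x)]; congr 1; linarith [hcoh x]
      rw [h1]
      simp only [hw]
      have : Real.exp (-ψ (F x)) * Real.exp (c - ψ x + ψ (F x)) = Real.exp c * Real.exp (- ψ x) := by
        rw [← Real.exp_add, ← Real.exp_add]; congr 1; ring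
      linear_combination Z⁻¹ * this
    have := is_const_of_deriv_eq_zero (fun x => (hd x).differentiableAt) (fun x => (hd x).deriv) x p
    simp only [hp, hUp] at this
    linarith
  have hUi : ∀ x (l : ℤ), U (x + l) = U x + l := by
    intro x l
    have := F_int (K := 1) (F := U) (by simpa using hU1) x l
    simpa using this
  have hcK : Real.exp c = K := by
    have h1 := hUF (p + 1)
    rw [hU1 p, hUp, hdeg, hp] at h1
    have h2 := hUi p K
    rw [hUp] at h2
    push_cast at h2
    rw [h2] at h1; linarith
  have hcoe : ∀ x : ℝ, ((U (rep (x : AddCircle (1:ℝ))) : ℝ) : AddCircle (1:ℝ)) = ((U x : ℝ) : AddCircle (1:ℝ)) := by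
    intro x
    obtain ⟨l, hl⟩ := rep_coe x
    rw [hl, hUi, coe_add_int]
  refine ⟨fun q => ((U (rep q) : ℝ) : AddCircle (1:ℝ)), U, ⟨?_, ?_⟩, ?_, ?_, hcoe, ?_⟩
  · intro q1 q2 h
    obtain ⟨l, hl⟩ := (coe_eq_iff _ _).1 h
    rw [← hUi] at hl
    have := hUm.injective hl
    rw [← coe_rep q1, ← coe_rep q2, this, coe_add_int]
  · intro q
    obtain ⟨x, hx⟩ := hUs (rep q)
    refine ⟨(x : AddCircle (1:ℝ)), ?_⟩
    simp only
    rw [hcoe, hx, coe_rep]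
  · rw [contDiff_one_iff_deriv]
    refine ⟨hUdiff, ?_⟩
    rw [hUderiv]; fun_prop
  · intro x
    rw [hUderiv]
    have : 0 < w x := Real.exp_pos _
    positivity
  · intro q
    rw [← coe_rep q]
    simp only
    rw [hfF, hcoe, hcoe, hUF, hcK, ← AddCircle.coe_nsmul, nsmul_eq_mul]

lemma transfer_coe (K : ℕ) (hK : 1 ≤ K) (F g : ℝ → ℝ) (hdeg : ∀ x : ℝ, F (x + 1) = F x + K)
    (hFg : ∀ x, F (g x) = x) (hgF : ∀ x, g (F x) = x)
    (f : AddCircle (1:ℝ) → AddCircle (1:ℝ))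
    (hfF : ∀ x : ℝ, f (x : AddCircle (1:ℝ)) = ((F x : ℝ) : AddCircle (1:ℝ)))
    (φ : AddCircle (1:ℝ) → ℝ) (x : ℝ) :
    transfer f φ x = ∑ i ∈ Finset.range K, φ ((g (x + i) : ℝ) : AddCircle (1:ℝ)) := by
  have hKz : (0:ℤ) < K := by exact_mod_cast hK
  have hgi : ∀ x (l : ℤ), g (x + K * l) = g x + l := by
    intro x l
    rw [← hgF (g x + l), F_int hdeg, hFg]
  have hset : f ⁻¹' {(x : AddCircle (1:ℝ))} =
      (fun i : ℕ => ((g (x + i) : ℝ) : AddCircle (1:ℝ))) '' (Finset.range K : Set ℕ) := by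
    ext q
    simp only [Set.mem_preimage, Set.mem_singleton_iff, Set.mem_image, Finset.coe_range, Set.mem_Iio]
    constructor
    · intro hq
      rw [← coe_rep q, hfF] at hq
      obtain ⟨l, hl⟩ := (coe_eq_iff _ _).1 hq
      have h1 := Int.emod_nonneg l hKz.ne'
      have h2 := Int.emod_lt_of_pos l hKz
      have h3 := Int.emod_add_mul_ediv l K
      refine ⟨(l % K).toNat, by omega, ?_⟩
      have h4 : (((l % K).toNat : ℕ) : ℝ) = ((l % K : ℤ) : ℝ) := by
        rw [← Int.cast_natCast, Int.toNat_of_nonneg h1]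
      have h5 : rep q = g (x + ((l % K).toNat : ℕ)) + (l / K : ℤ) := by
        rw [← hgi, ← hgF (rep q), hl, h4, add_assoc]
        congr 2
        exact_mod_cast h3.symm
      rw [← coe_rep q, h5, coe_add_int]
    · rintro ⟨i, hi, rfl⟩
      rw [hfF, hFg]
      have := coe_add_int x i
      simpa using this
  have hinj : Set.InjOn (fun i : ℕ => ((g (x + i) : ℝ) : AddCircle (1:ℝ))) (Finset.range K : Set ℕ) := by
    intro i hi j hj hij
    simp only [Finset.coe_range, Set.mem_Iio] at hi hj
    obtain ⟨l, hl⟩ := (coe_eq_iff _ _).1 hij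
    have h1 := congrArg F hl
    rw [F_int hdeg, hFg, hFg] at h1
    have h2 : (i : ℤ) = j + K * l := by
      have : (i : ℝ) = j + K * l := by linarith
      exact_mod_cast this
    have h3 : (i : ℤ) % K = j % K := by rw [h2]; simp
    rw [Int.emod_eq_of_lt (by positivity) (by exact_mod_cast hi),
      Int.emod_eq_of_lt (by positivity) (by exact_mod_cast hj)] at h3
    exact_mod_cast h3
  unfold transfer
  rw [hset, finsum_mem_image hinj, finsum_mem_coe_finset]


/-! ### Construction of the system and periodic points -/

lemma exists_sys (K : ℕ) (hK : 2 ≤ K) (F : ℝ → ℝ) (hF : ContDiff ℝ 2 F)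
    (hdeg : ∀ x : ℝ, F (x + 1) = F x + K)
    (lam : ℝ) (hlam : 1 < lam) (hexp : ∀ x : ℝ, lam ≤ deriv F x)
    (f : AddCircle (1:ℝ) → AddCircle (1:ℝ))
    (hfF : ∀ x : ℝ, f (x : AddCircle (1:ℝ)) = ((F x : ℝ) : AddCircle (1:ℝ)))
    (μ : Measure (AddCircle (1:ℝ))) [IsProbabilityMeasure μ]
    (hμ : ∀ φ : AddCircle (1:ℝ) → ℝ, Continuous φ → ∫ x, transfer f φ x ∂μ = (K : ℝ) * ∫ x, φ x ∂μ) :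
    ∃ (g : ℝ → ℝ) (LF : ℝ), Sys K F g lam⁻¹ LF (fun φ => ∫ q, φ (rep q) ∂μ) := by
  have hFd : Differentiable ℝ F := hF.differentiable (by norm_num)
  have hE := expand_of_deriv hFd lam hexp
  obtain ⟨hs, hm⟩ := expand_surj hFd.continuous lam (by linarith) hE
  set g := Function.surjInv hs with hg
  have hFg : ∀ x, F (g x) = x := Function.surjInv_eq hs
  have hgF : ∀ x, g (F x) = x := fun x => hm.injective (hFg _)
  obtain ⟨LF, hLF⟩ := lip_of_c1 (φ := F) (hF.of_le (by norm_num)) (deriv_shift hdeg)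
  have hintg : ∀ φ : ℝ → ℝ, Continuous φ → (∀ x, φ (x + 1) = φ x) →
      Integrable (fun q => φ (rep q)) μ := by
    intro φ hc hp
    have hc' := cont_rep hc hp
    obtain ⟨B, hB⟩ := per_bdd hc hp
    exact Integrable.of_bound hc'.aestronglyMeasurable B (Eventually.of_forall fun q => hB _)
  have hK0 : (0:ℝ) < K := by exact_mod_cast (by omega : 0 < K)
  refine ⟨g, LF, ⟨by omega, by positivity, inv_lt_one_of_one_lt₀ hlam, hFg, hgF, ?_, hdeg, ?_, hLF,
    ?_, ?_, ?_, ?_⟩⟩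
  · intro x
    apply hm.injective
    rw [hdeg, hFg, hFg]
  · have key : ∀ x y, g x ≤ g y → |g x - g y| ≤ lam⁻¹ * |x - y| := by
      intro x y hxy
      have h1 := hE (g x) (g y) hxy
      rw [hFg, hFg] at h1
      rw [abs_sub_comm, abs_of_nonneg (by linarith), inv_mul_eq_div, le_div_iff₀ (by linarith)]
      rw [abs_sub_comm]
      calc _ = lam * (g y - g x) := by ring
        _ ≤ y - x := h1
        _ ≤ _ := le_abs_self _
    intro x y
    rcases le_total (g x) (g y) with h | h
    · exact key x y h
    · rw [abs_sub_comm, abs_sub_comm x y]; exact key y x h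
  · intro φ c hc hp h
    have := integral_mono (μ := μ) (integrable_const c) (hintg φ hc hp) (fun q => h (rep q))
    simpa using this
  · intro φ c hc hp h
    have := integral_mono (μ := μ) (hintg φ hc hp) (integrable_const c) (fun q => h (rep q))
    simpa using this
  · intro φ hc hp
    have h1 : ∀ q, Lop K g φ (rep q) = (K:ℝ)⁻¹ * transfer f (fun q => φ (rep q)) q := by
      intro q
      conv_rhs => rw [← coe_rep q]
      rw [transfer_coe K (by omega) F g hdeg hFg hgF f hfF, Lop_apply]
      congr 1
      exact Finset.sum_congr rfl fun i _ => (per_rep hp _).symm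
    have h2 := hμ _ (cont_rep hc hp)
    simp only [h1]
    rw [integral_const_mul, h2]
    field_simp
  · intro φ c hc hp
    have := integral_sub (hintg φ hc hp) (integrable_const (μ := μ) c)
    simpa using this

lemma F_iter_int {K : ℕ} {F : ℝ → ℝ} (hdeg : ∀ x : ℝ, F (x + 1) = F x + K) (n : ℕ) (x : ℝ) (l : ℤ) :
    F^[n] (x + l) = F^[n] x + (K:ℝ)^n * l := by
  induction n generalizing x l with
  | zero => simp
  | succ n ih =>
    rw [Function.iterate_succ_apply, F_int hdeg, Function.iterate_succ_apply]
    have := ih (F x) (K * l)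
    push_cast at this
    rw [this]; ring

lemma f_iter_coe {F : ℝ → ℝ} {f : AddCircle (1:ℝ) → AddCircle (1:ℝ)}
    (hfF : ∀ x : ℝ, f (x : AddCircle (1:ℝ)) = ((F x : ℝ) : AddCircle (1:ℝ))) (n : ℕ) (x : ℝ) :
    f^[n] (x : AddCircle (1:ℝ)) = ((F^[n] x : ℝ) : AddCircle (1:ℝ)) := by
  induction n generalizing x with
  | zero => rfl
  | succ n ih => rw [Function.iterate_succ_apply, hfF, ih, Function.iterate_succ_apply]

lemma iter_expand {F : ℝ → ℝ} {lam : ℝ} (hlam : 1 < lam)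
    (hE : ∀ x y, x ≤ y → lam * (y - x) ≤ F y - F x) (n : ℕ) :
    ∀ x y, x ≤ y → lam^n * (y - x) ≤ F^[n] y - F^[n] x := by
  induction n with
  | zero => intro x y _; simp
  | succ n ih =>
    intro x y hxy
    have h1 := hE x y hxy
    have h0 : 0 ≤ lam * (y - x) := mul_nonneg (by linarith) (by linarith)
    have h2 := ih (F x) (F y) (by linarith)
    rw [Function.iterate_succ_apply, Function.iterate_succ_apply]
    refine le_trans ?_ h2
    rw [pow_succ, mul_assoc]
    exact mul_le_mul_of_nonneg_left h1 (by positivity)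

lemma per_points (K : ℕ) (hK : 2 ≤ K) (F : ℝ → ℝ) (hFc : Continuous F)
    (hdeg : ∀ x : ℝ, F (x + 1) = F x + K) (lam : ℝ) (hlam : 1 < lam)
    (hE : ∀ x y, x ≤ y → lam * (y - x) ≤ F y - F x)
    (f : AddCircle (1:ℝ) → AddCircle (1:ℝ))
    (hfF : ∀ x : ℝ, f (x : AddCircle (1:ℝ)) = ((F x : ℝ) : AddCircle (1:ℝ)))
    (p : ℝ) (hp : F p = p) (n : ℕ) (hn : 1 ≤ n) :
    ∃ X : ℕ → ℝ, (∀ j, F^[n] (X j) = X j + j) ∧ (∀ j < K^n - 1, p ≤ X j ∧ X j ≤ p + 1) ∧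
      Set.BijOn (fun j => (X j : AddCircle (1:ℝ))) (Set.Iio (K^n - 1)) (FixPts f n) := by
  have hKn : 2 ≤ K^n := hK.trans (Nat.le_self_pow (by omega) K)
  obtain ⟨N, hN⟩ : ∃ N, K^n = N + 1 := ⟨K^n - 1, by omega⟩
  have hN1 : 1 ≤ N := by omega
  have hNr : (K:ℝ)^n = N + 1 := by exact_mod_cast hN
  rw [hN, Nat.add_sub_cancel]
  have hl : 1 < lam^n := one_lt_pow₀ hlam (by omega)
  set T : ℝ → ℝ := fun x => F^[n] x - x with hT
  obtain ⟨hs, hm⟩ := expand_surj (T := T) ((hFc.iterate n).sub continuous_id) (lam^n - 1) (by linarith)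
    (fun x y hxy => by
      have := iter_expand hlam hE n x y hxy
      simp only [hT]; linarith)
  have hTi : ∀ x (l : ℤ), T (x + l) = T x + N * l := by
    intro x l
    simp only [hT]; rw [F_iter_int hdeg, hNr]; ring
  have hTp : T p = 0 := by
    simp only [hT]; rw [Function.iterate_fixed hp, sub_self]
  choose X hX using fun j : ℕ => hs (j:ℝ)
  have hge : ∀ j, p ≤ X j := fun j => hm.le_iff_le.1 (by rw [hTp, hX]; positivity)
  have hlt : ∀ j < N, X j < p + 1 := fun j hj => hm.lt_iff_lt.1 (by
    have := hTi p 1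
    simp only [Int.cast_one, mul_one] at this
    rw [this, hTp, hX, zero_add]; exact_mod_cast hj)
  refine ⟨X, fun j => ?_, fun j hj => ⟨hge j, (hlt j hj).le⟩, ?_, ?_, ?_⟩
  · have := hX j; simp only [hT] at this; linarith
  · intro j _
    simp only [FixPts, Set.mem_ofPred_eq]
    rw [f_iter_coe hfF, coe_eq_iff]
    refine ⟨j, ?_⟩
    have := hX j; simp only [hT] at this; push_cast; linarith
  · intro i hi j hj hij
    simp only [Set.mem_Iio] at hi hj
    obtain ⟨l, hl⟩ := (coe_eq_iff _ _).1 hij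
    have h1 := hge i; have h2 := hge j; have h3 := hlt i hi; have h4 := hlt j hj
    have h5 : l = 0 := by
      have a1 : (l:ℝ) < 1 := by linarith
      have a2 : (-1:ℝ) < l := by linarith
      have a1' : l < 1 := by exact_mod_cast a1
      have a2' : -1 < l := by exact_mod_cast a2
      omega
    rw [h5] at hl
    have h6 := congrArg T hl
    simp only [Int.cast_zero, add_zero] at h6
    rw [hX, hX] at h6
    exact_mod_cast h6
  · intro q hq
    simp only [FixPts, Set.mem_ofPred_eq] at hq
    rw [← coe_rep q, f_iter_coe hfF] at hq
    obtain ⟨l, hl⟩ := (coe_eq_iff _ _).1 hq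
    have hNz : (0:ℤ) < N := by exact_mod_cast hN1
    have h1 := Int.emod_nonneg l hNz.ne'
    have h2 := Int.emod_lt_of_pos l hNz
    have h3 := Int.emod_add_mul_ediv l N
    refine ⟨(l % N).toNat, by simp only [Set.mem_Iio]; omega, ?_⟩
    have h4 : (((l % N).toNat : ℕ) : ℝ) = ((l % N : ℤ) : ℝ) := by
      rw [← Int.cast_natCast, Int.toNat_of_nonneg h1]
    have h5 : rep q = X ((l % N).toNat) + (l / N : ℤ) := by
      apply hm.injective
      rw [hTi, hX, h4]
      have : T (rep q) = l := by simp only [hT]; linarith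
      rw [this]
      exact_mod_cast h3.symm
    simp only
    rw [← coe_rep q, h5, coe_add_int]

/-! ### Comparison of Birkhoff sums -/

lemma Sg_birkhoff {F g : ℝ → ℝ} (hgF : ∀ x, g (F x) = x) (h : ℝ → ℝ) (n : ℕ) (x : ℝ) :
    Sg g h n (F^[n] x) = ∑ k ∈ Finset.range n, h (F^[k] x) := by
  induction n with
  | zero => simp [Sg]
  | succ n ih =>
    rw [Sg_succ, Function.iterate_succ_apply', hgF, ih, Finset.sum_range_succ, add_comm]

lemma Sg_cob {F g : ℝ → ℝ} (hFg : ∀ x, F (g x) = x) (h m ψ : ℝ → ℝ) (c : ℝ)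
    (hm : ∀ x, m x = h x - c + ψ x - ψ (F x)) (n : ℕ) (z : ℝ) :
    Sg g m n z = Sg g h n z - n * c + ψ (g^[n] z) - ψ z := by
  induction n generalizing z with
  | zero => simp [Sg]
  | succ n ih =>
    rw [Sg_succ, Sg_succ, ih, hm, hFg, Function.iterate_succ_apply]
    push_cast; ring

lemma Sg_lip {g : ℝ → ℝ} {r : ℝ} (hr0 : 0 ≤ r) (hr1 : r < 1) (hgL : ∀ x y, |g x - g y| ≤ r * |x - y|)
    {A : ℝ} {h : ℝ → ℝ} (hh : LP A h) (n : ℕ) (z z' : ℝ) :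
    |Sg g h n z - Sg g h n z'| ≤ A / (1 - r) * |z - z'| := by
  have hA := hh.nonneg
  have h1r : 0 < 1 - r := by linarith
  induction n generalizing z z' with
  | zero => simp [Sg]; positivity
  | succ n ih =>
    rw [Sg_succ, Sg_succ]
    have h1 := hh.lip (g z) (g z')
    have h2 := ih (g z) (g z')
    have h3 := hgL z z'
    have h4 : A * |g z - g z'| + A / (1 - r) * |g z - g z'| ≤ A / (1 - r) * |z - z'| := by
      have e : A / (1 - r) * |z - z'| = (A + A / (1 - r)) * (r * |z - z'|) + A * (1 - r) * |z - z'| := by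
        field_simp; ring
      rw [e, ← add_mul]
      have : (A + A / (1 - r)) * |g z - g z'| ≤ (A + A / (1 - r)) * (r * |z - z'|) :=
        mul_le_mul_of_nonneg_left h3 (by positivity)
      have : 0 ≤ A * (1 - r) * |z - z'| := by positivity
      linarith
    calc _ = |(h (g z) - h (g z')) + (Sg g h n (g z) - Sg g h n (g z'))| := by congr 1; ring
      _ ≤ _ := (abs_add_le _ _).trans (by linarith)


open Classical in
lemma card_bij {S : Set (AddCircle (1:ℝ))} {N : ℕ} {Y : ℕ → AddCircle (1:ℝ)}
    (hY : Set.BijOn Y (Set.Iio N) S) (Q : AddCircle (1:ℝ) → Prop) :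
    Nat.card {q : AddCircle (1:ℝ) // q ∈ S ∧ Q q} =
      ((Finset.range N).filter (fun j => Q (Y j))).card := by
  have h : {q | q ∈ S ∧ Q q} = Y '' ((Finset.range N).filter (fun j => Q (Y j)) : Set ℕ) := by
    ext q
    simp only [Set.mem_ofPred_eq, Set.mem_image, Finset.coe_filter, Finset.mem_range]
    constructor
    · rintro ⟨h1, h2⟩
      obtain ⟨j, hj, rfl⟩ := hY.surjOn h1
      exact ⟨j, ⟨hj, h2⟩, rfl⟩
    · rintro ⟨j, ⟨hj, h2⟩, rfl⟩
      exact ⟨hY.mapsTo hj, h2⟩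
  have h2 : Nat.card {q : AddCircle (1:ℝ) // q ∈ S ∧ Q q} = Set.ncard {q | q ∈ S ∧ Q q} := rfl
  rw [h2, h, Set.ncard_image_of_injOn, Set.ncard_coe_finset]
  intro i hi j hj hij
  simp only [Finset.coe_filter, Finset.mem_range, Set.mem_ofPred_eq] at hi hj
  exact hY.injOn hi.1 hj.1 hij

open Classical in
lemma count_compare (N : ℕ) (hN : 1 ≤ N) (M : ℕ → ℝ) (s E C1 : ℝ) (hs : 0 < s) (hC1 : 0 ≤ C1)
    (hclt : ∀ u : ℝ, |((N:ℝ)+1)⁻¹ * ((Finset.range (N+1)).filter (fun j : ℕ => M j ≤ u)).card -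
      Phi (u / s)| ≤ E)
    (P : ℕ → Prop) (w : ℝ) (h1 : ∀ j < N, M j ≤ w - C1 → P j) (h2 : ∀ j < N, P j → M j ≤ w + C1) :
    |((Finset.range N).filter (fun j => P j)).card / (N:ℝ) - Phi (w / s)| ≤ E + C1 / s + 1 / N := by
  have hN0 : (0:ℝ) < N := by exact_mod_cast hN
  set a := ((Finset.range N).filter (fun j => P j)).card with ha
  have haN : a ≤ N := by
    have := Finset.card_filter_le (Finset.range N) (fun j => P j)
    simpa using this
  have haN' : (a:ℝ) ≤ N := by exact_mod_cast haN
  have hU : a ≤ ((Finset.range (N+1)).filter (fun j : ℕ => M j ≤ w + C1)).card := by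
    apply Finset.card_le_card
    intro j hj
    simp only [Finset.mem_filter, Finset.mem_range] at hj ⊢
    exact ⟨by omega, h2 j hj.1 hj.2⟩
  have hL : ((Finset.range (N+1)).filter (fun j : ℕ => M j ≤ w - C1)).card ≤ a + 1 := by
    have : ((Finset.range (N+1)).filter (fun j : ℕ => M j ≤ w - C1)) ⊆
        insert N ((Finset.range N).filter (fun j => P j)) := by
      intro j hj
      simp only [Finset.mem_filter, Finset.mem_range, Finset.mem_insert] at hj ⊢
      by_cases e : j = N
      · exact Or.inl e
      · exact Or.inr ⟨by omega, h1 j (by omega) hj.2⟩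
    exact (Finset.card_le_card this).trans (Finset.card_insert_le _ _)
  have hU' : (a:ℝ) ≤ ((Finset.range (N+1)).filter (fun j : ℕ => M j ≤ w + C1)).card := by
    exact_mod_cast hU
  have hL' : (((Finset.range (N+1)).filter (fun j : ℕ => M j ≤ w - C1)).card : ℝ) ≤ a + 1 := by
    exact_mod_cast hL
  have c1 := (abs_le.1 (hclt (w + C1))).2
  have c2 := (abs_le.1 (hclt (w - C1))).1
  have p1 := (abs_le.1 (Phi_lip ((w + C1)/s) (w/s))).2
  have p2 := (abs_le.1 (Phi_lip (w/s) ((w - C1)/s))).2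
  have e1 : (w + C1)/s - w/s = C1/s := by ring
  have e2 : w/s - (w - C1)/s = C1/s := by ring
  have hCs : 0 ≤ C1 / s := by positivity
  rw [e1, abs_of_nonneg hCs] at p1
  rw [e2, abs_of_nonneg hCs] at p2
  have k1 : (a:ℝ)/N ≤ ((N:ℝ)+1)⁻¹ * a + 1/N := by
    rw [inv_mul_eq_div, div_add_div _ _ (by positivity) (by positivity), div_le_div_iff₀ (by positivity) (by positivity)]
    nlinarith
  have k2 : ((N:ℝ)+1)⁻¹ * (a + 1) ≤ (a:ℝ)/N + 1/N := by
    rw [inv_mul_eq_div, ← add_div]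
    exact div_le_div_of_nonneg_left (by positivity) hN0 (by linarith)
  have q1 := mul_le_mul_of_nonneg_left hU' (by positivity : 0 ≤ ((N:ℝ)+1)⁻¹)
  have q2 := mul_le_mul_of_nonneg_left hL' (by positivity : 0 ≤ ((N:ℝ)+1)⁻¹)
  rw [abs_le]
  constructor <;> linarith

lemma card_split (N : ℕ) (Z : ℕ → ℝ) (a b : ℝ) (hab : a < b) [DecidablePred fun j => a ≤ Z j ∧ Z j ≤ b]
    [DecidablePred fun j => Z j ≤ b] [DecidablePred fun j => Z j < a] :
    (((Finset.range N).filter (fun j => a ≤ Z j ∧ Z j ≤ b)).card : ℝ) =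
      ((Finset.range N).filter (fun j => Z j ≤ b)).card -
      ((Finset.range N).filter (fun j => Z j < a)).card := by
  rw [eq_sub_iff_add_eq]
  have : Disjoint ((Finset.range N).filter (fun j => a ≤ Z j ∧ Z j ≤ b))
      ((Finset.range N).filter (fun j => Z j < a)) := by
    rw [Finset.disjoint_filter]
    intro j _ h1 h2
    linarith [h1.1]
  have h2 := Finset.card_union_of_disjoint this
  rw [← Finset.filter_or] at h2
  rw [← Nat.cast_add, ← h2]
  congr 2
  ext j
  simp only [Finset.mem_filter, Finset.mem_range]
  constructor
  · rintro ⟨h, h3 | h3⟩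
    · exact ⟨h, h3.2⟩
    · exact ⟨h, by linarith⟩
  · rintro ⟨h, h3⟩
    refine ⟨h, ?_⟩
    rcases le_or_gt a (Z j) with h4 | h4
    · exact Or.inl ⟨h4, h3⟩
    · exact Or.inr h4

lemma card_split_top (N : ℕ) (Z : ℕ → ℝ) (a : ℝ) [DecidablePred fun j => a ≤ Z j]
    [DecidablePred fun j => Z j < a] :
    (((Finset.range N).filter (fun j => a ≤ Z j)).card : ℝ) =
      N - ((Finset.range N).filter (fun j => Z j < a)).card := by
  rw [eq_sub_iff_add_eq]
  have : Disjoint ((Finset.range N).filter (fun j => a ≤ Z j))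
      ((Finset.range N).filter (fun j => Z j < a)) := by
    rw [Finset.disjoint_filter]
    intro j _ h1 h2
    linarith
  have h2 := Finset.card_union_of_disjoint this
  rw [← Finset.filter_or] at h2
  rw [← Nat.cast_add, ← h2]
  congr 1
  rw [Finset.filter_true_of_mem (fun j _ => le_or_gt a (Z j)), Finset.card_range]

open Classical in
lemma final_est (N : ℕ) (hN : 1 ≤ N) (Z : ℕ → ℝ) (R : ℝ) (hR : 0 ≤ R)
    (hle : ∀ b : ℝ, |((Finset.range N).filter (fun j => Z j ≤ b)).card / (N:ℝ) - Phi b| ≤ R)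
    (hlt : ∀ a : ℝ, |((Finset.range N).filter (fun j => Z j < a)).card / (N:ℝ) - Phi a| ≤ R)
    (a b : EReal) (ha : a ≠ ⊥) (hb : b ≠ ⊥) (hab : a < b) :
    |(((Finset.range N).filter (fun j => a ≤ (Z j : EReal) ∧ (Z j : EReal) ≤ b)).card : ℝ) / N -
      (Real.sqrt (2 * Real.pi))⁻¹ *
        ∫ x in {y : ℝ | a ≤ (y : EReal) ∧ (y : EReal) ≤ b}, Real.exp (-x ^ 2 / 2)| ≤ 2 * R := by
  have hN0 : (0:ℝ) < N := by exact_mod_cast hN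
  lift a to ℝ using ⟨(lt_of_lt_of_le hab le_top).ne, ha⟩
  have h1 := abs_le.1 (hlt a)
  induction b with
  | bot => exact absurd rfl hb
  | top =>
    simp only [le_top, and_true, EReal.coe_le_coe_iff]
    rw [card_split_top, sub_div, div_self hN0.ne']
    have : {y : ℝ | a ≤ y} = Set.Ici a := rfl
    rw [this, integral_Ici_eq_integral_Ioi, ← one_sub_Phi, abs_le]
    constructor <;> linarith [h1.1, h1.2]
  | coe b =>
    rw [EReal.coe_lt_coe_iff] at hab
    simp only [EReal.coe_le_coe_iff]
    rw [card_split _ _ _ _ hab, sub_div]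
    have h2 := abs_le.1 (hle b)
    have : {y : ℝ | a ≤ y ∧ y ≤ b} = Set.Icc a b := rfl
    rw [this, integral_Icc_eq_integral_Ioc, ← intervalIntegral.integral_of_le hab.le, ← Phi_sub, abs_le]
    constructor <;> linarith [h1.1, h1.2, h2.1, h2.2]


/-- Main Theorem (distribution of periodic Lyapunov exponents): if `f` is not smoothly
conjugate to the linear map, then there are `σ > 0` and `C > 0` such that for all `n ≥ 1`
and all `a < b` in `ℝ ∪ {+∞}` (encoded as `EReal`s different from `⊥`),
the probability that `√n(χ_n - χ̄)/σ ∈ [a,b]` differs from the Gaussian integral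
`(2π)^{-1/2} ∫_a^b e^{-x²/2} dx` by at most `C n^{-1/4}`. -/
theorem stmt17
    (K : ℕ) (hK : 2 ≤ K)
    (F : ℝ → ℝ) (hF : ContDiff ℝ 2 F)
    (hdeg : ∀ x : ℝ, F (x + 1) = F x + K)
    (lam : ℝ) (hlam : 1 < lam)
    (hexp : ∀ x : ℝ, lam ≤ deriv F x)
    (f : AddCircle (1:ℝ) → AddCircle (1:ℝ))
    (hfF : ∀ x : ℝ, f (x : AddCircle (1:ℝ)) = ((F x : ℝ) : AddCircle (1:ℝ)))
    (f' : AddCircle (1:ℝ) → ℝ)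
    (hf'F : ∀ x : ℝ, f' (x : AddCircle (1:ℝ)) = deriv F x)
    (μ : Measure (AddCircle (1:ℝ))) [IsProbabilityMeasure μ]
    (hinv : ∀ φ : AddCircle (1:ℝ) → ℝ, Continuous φ → ∫ x, φ (f x) ∂μ = ∫ x, φ x ∂μ)
    (hμ : ∀ φ : AddCircle (1:ℝ) → ℝ, Continuous φ → ∫ x, transfer f φ x ∂μ = (K : ℝ) * ∫ x, φ x ∂μ)
    (hnc : ¬ SmoothConj K f) :
    ∃ sigma C : ℝ, 0 < sigma ∧ 0 < C ∧
      ∀ n : ℕ, 1 ≤ n → ∀ a b : EReal, a ≠ ⊥ → b ≠ ⊥ → a < b →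
        |(Nat.card {p : AddCircle (1:ℝ) // p ∈ FixPts f n ∧
              a ≤ ((Real.sqrt n * (chi f f' n p - ∫ y, Real.log (f' y) ∂μ) / sigma : ℝ) : EReal) ∧
              ((Real.sqrt n * (chi f f' n p - ∫ y, Real.log (f' y) ∂μ) / sigma : ℝ) : EReal) ≤ b} : ℝ) /
            (Nat.card (FixPts f n) : ℝ) -
          (Real.sqrt (2 * Real.pi))⁻¹ *
            ∫ x in {y : ℝ | a ≤ (y : EReal) ∧ (y : EReal) ≤ b}, Real.exp (-x ^ 2 / 2)| ≤
        C / (n : ℝ) ^ ((1 : ℝ) / 4) := by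
  classical
  have hFd : Differentiable ℝ F := hF.differentiable (by norm_num)
  have hE := expand_of_deriv hFd lam hexp
  obtain ⟨g, LF, S⟩ := exists_sys K hK F hF hdeg lam hlam hexp f hfF μ hμ
  have hpos : ∀ x, 0 < deriv F x := fun x => by linarith [hexp x]
  have hdd : ∀ x, deriv F (x + 1) = deriv F x := deriv_shift hdeg
  have hC1 : ContDiff ℝ 1 (deriv F) := by
    have : ContDiff ℝ (1 + 1) F := by norm_num; exact hF
    exact (contDiff_succ_iff_deriv.1 this).2.2
  set h : ℝ → ℝ := fun x => Real.log (deriv F x) with hh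
  have hhp : ∀ x, h (x + 1) = h x := fun x => by simp only [hh, hdd]
  have hhC1 : ContDiff ℝ 1 h := hC1.log (fun x => (hpos x).ne')
  obtain ⟨A, hA⟩ := lip_of_c1 hhC1 (deriv_shift (c := 0) (by simpa using hhp))
  have hLP : LP A h := ⟨hhp, hA⟩
  have hlog : ∀ q, Real.log (f' q) = h (rep q) := fun q => by
    conv_lhs => rw [← coe_rep q]
    rw [hf'F]
  have hc : ∫ y, Real.log (f' y) ∂μ = ∫ q, h (rep q) ∂μ := by simp only [hlog]
  rw [hc]
  obtain ⟨ψ, m, η, v, B, A', hψ, hm, hmp, hv0, hmB, hηB, hψB, hm0, hme, hv⟩ := decomposition S hLP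
  set c := ∫ q, h (rep q) ∂μ with hcdef
  -- the fixed point
  obtain ⟨hs, -⟩ := expand_surj (T := fun x => F x - x) (hFd.continuous.sub continuous_id) (lam - 1)
    (by linarith) (fun x y hxy => by have := hE x y hxy; linarith)
  obtain ⟨p, hp⟩ := hs 0
  have hp : F p = p := by simp only at hp; linarith
  have hv : 0 < v := by
    refine lt_of_le_of_ne hv0 fun e => hnc ?_
    have := hv e.symm
    refine smooth_conj K F hF hdeg hpos f hfF p hp ψ hψ.cont hψ.per c fun x => ?_
    have h1 := hm x
    rw [this x] at h1
    exact h1.symm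
  obtain ⟨C, hC, hclt⟩ := clt K (by omega) g m η S.hg1 hmp v B hv hmB hηB hm0 hme
  have hsv := Real.sqrt_pos.2 hv
  have hB : 0 ≤ B := (abs_nonneg _).trans (hmB 0)
  have hA0 := hLP.nonneg
  have h1r : 0 < 1 - lam⁻¹ := by linarith [S.hr1]
  set C0 := A / (1 - lam⁻¹) + 2 * B with hC0
  have hC00 : 0 ≤ C0 := by positivity
  refine ⟨Real.sqrt v, 2 * (C + (C0 + 1) / Real.sqrt v + 1), hsv, by positivity, ?_⟩
  intro n hn a b ha hb hab
  have hn0 : (0:ℝ) < n := by exact_mod_cast hn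
  have hn1 : (1:ℝ) ≤ n := by exact_mod_cast hn
  have hsn := Real.sqrt_pos.2 hn0
  obtain ⟨X, hX, hXp, hbij⟩ := per_points K hK F hFd.continuous hdeg lam hlam hE f hfF p hp n hn
  have hKn : n + 1 ≤ K ^ n := by
    have h1 : n + 1 ≤ 2 ^ n := Nat.lt_two_pow_self
    exact h1.trans (Nat.pow_le_pow_left hK n)
  obtain ⟨N, hN⟩ : ∃ N, K ^ n = N + 1 := ⟨K ^ n - 1, by omega⟩
  have hNn : n ≤ N := by omega
  have hN1 : 1 ≤ N := by omega
  have hNr : (K:ℝ) ^ n = N + 1 := by exact_mod_cast hN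
  rw [hN, Nat.add_sub_cancel] at hXp hbij
  have hcardN : Nat.card (FixPts f n) = N := by
    have := card_bij hbij (fun _ => True)
    simp only [and_true, Finset.filter_true, Finset.card_range] at this
    exact this
  rw [card_bij hbij (fun q => a ≤ ((Real.sqrt n * (chi f f' n q - c) / Real.sqrt v : ℝ) : EReal) ∧
    ((Real.sqrt n * (chi f f' n q - c) / Real.sqrt v : ℝ) : EReal) ≤ b), hcardN]
  set s := Real.sqrt v * Real.sqrt n with hsdef
  have hs0 : 0 < s := by positivity
  set Z : ℕ → ℝ := fun j => Real.sqrt n * (chi f f' n (X j : AddCircle (1:ℝ)) - c) / Real.sqrt v with hZ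
  have hZT : ∀ j, Z j * s = ∑ k ∈ Finset.range n, h (F^[k] (X j)) - n * c := by
    intro j
    have h1 : chi f f' n (X j : AddCircle (1:ℝ)) = (n:ℝ)⁻¹ * ∑ k ∈ Finset.range n, h (F^[k] (X j)) := by
      unfold chi
      congr 1
      refine Finset.sum_congr rfl fun k _ => ?_
      rw [f_iter_coe hfF, hf'F]
    simp only [hZ, hsdef]
    rw [h1]
    have h2 : Real.sqrt n * Real.sqrt n = n := Real.mul_self_sqrt hn0.le
    generalize ∑ k ∈ Finset.range n, h (F^[k] (X j)) = W
    calc _ = (Real.sqrt n * Real.sqrt n) * ((n:ℝ)⁻¹ * W - c) := by field_simp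
      _ = _ := by rw [h2]; field_simp
  have hcmp : ∀ j < N, |Z j * s - Sg g m n (p + j)| ≤ C0 := by
    intro j hj
    rw [hZT, ← Sg_birkhoff S.hgF, hX, Sg_cob S.hFg h m ψ c hm]
    have h1 := Sg_lip S.hr0 S.hr1 S.hgL hLP n (X j + j) (p + j)
    obtain ⟨h2, h3⟩ := hXp j hj
    have h4 : |X j + j - (p + j)| ≤ 1 := by rw [abs_le]; constructor <;> linarith
    have h5 := mul_le_mul_of_nonneg_left h4 (by positivity : 0 ≤ A / (1 - lam⁻¹))
    have h6 := abs_le.1 (hψB (g^[n] (p + j)))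
    have h7 := abs_le.1 (hψB (p + j))
    have h8 := abs_le.1 h1
    rw [abs_le]
    constructor <;> linarith [h6.1, h6.2, h7.1, h7.2, h8.1, h8.2]
  have hq : (0:ℝ) < (n:ℝ) ^ ((1:ℝ)/4) := Real.rpow_pos_of_pos hn0 _
  have hq1 : (n:ℝ) ^ ((1:ℝ)/4) ≤ Real.sqrt n := by
    rw [Real.sqrt_eq_rpow]
    exact Real.rpow_le_rpow_of_exponent_le hn1 (by norm_num)
  have hq2 : (n:ℝ) ^ ((1:ℝ)/4) ≤ N := by
    have h1 : (n:ℝ) ^ ((1:ℝ)/4) ≤ (n:ℝ) ^ (1:ℝ) := Real.rpow_le_rpow_of_exponent_le hn1 (by norm_num)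
    rw [Real.rpow_one] at h1
    exact h1.trans (by exact_mod_cast hNn)
  have hR : C / (n:ℝ) ^ ((1:ℝ)/4) + (C0 + 1) / s + 1 / N ≤
      (C + (C0 + 1) / Real.sqrt v + 1) / (n:ℝ) ^ ((1:ℝ)/4) := by
    rw [add_div (C + (C0 + 1) / Real.sqrt v), add_div C]
    have h1 : (C0 + 1) / s ≤ (C0 + 1) / Real.sqrt v / (n:ℝ) ^ ((1:ℝ)/4) := by
      rw [hsdef, ← div_div]
      exact div_le_div_of_nonneg_left (by positivity) hq hq1
    have h2 : 1 / (N:ℝ) ≤ 1 / (n:ℝ) ^ ((1:ℝ)/4) := div_le_div_of_nonneg_left (by norm_num) hq hq2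
    linarith
  have hclt' := hclt n hn p
  rw [hN, hNr] at hclt'
  rw [mul_div_assoc]
  have key := final_est N hN1 Z ((C + (C0 + 1) / Real.sqrt v + 1) / (n:ℝ) ^ ((1:ℝ)/4)) (by positivity) ?_ ?_ a b ha hb hab
  · convert key
  · intro b
    have := count_compare N hN1 (fun j => Sg g m n (p + j)) s _ (C0 + 1) hs0 (by positivity) hclt'
      (fun j => Z j ≤ b) (b * s) ?_ ?_
    · rw [mul_div_cancel_right₀ _ hs0.ne'] at this
      exact this.trans hR
    · intro j hj h1
      have h2 := (abs_le.1 (hcmp j hj)).2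
      exact le_of_mul_le_mul_right (by linarith) hs0
    · intro j hj h1
      have h2 := (abs_le.1 (hcmp j hj)).1
      have h3 := mul_le_mul_of_nonneg_right h1 hs0.le
      linarith
  · intro a
    have := count_compare N hN1 (fun j => Sg g m n (p + j)) s _ (C0 + 1) hs0 (by positivity) hclt'
      (fun j => Z j < a) (a * s) ?_ ?_
    · rw [mul_div_cancel_right₀ _ hs0.ne'] at this
      exact this.trans hR
    · intro j hj h1
      have h2 := (abs_le.1 (hcmp j hj)).2
      exact lt_of_mul_lt_mul_right (by linarith) hs0.le
    · intro j hj h1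
      have h2 := (abs_le.1 (hcmp j hj)).1
      have h3 := mul_le_mul_of_nonneg_right h1.le hs0.le
      linarith
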